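/- arXiv:math/0607396 — 2 statements merged into one kernel-verified Lean document; each statement's English description precedes it below -/
import Mathlib

section
/- The d-braxtope Q = Q^{d,n} (n ≥ d ≥ 3) is elementary: f_{{0,2}}(Q) - 3·f_2(Q) + f_1(Q) - d·f_0(Q) + C(d+1, 2) = 0, where f_{{0,2}}(Q) is the number of chains (vertex ⊂ 2-face) of Q. -/
open Set

noncomputable section

variable {V : Type*} [NormedAddCommGroup V] [NormedSpace ℝ V]

open Classical in
/-- Affine dimension of a set: `-1` for the empty set, otherwise the
dimension of its affine hull. -/
def sdim (s : Set V) : ℤ :=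
  if s.Nonempty then (Module.finrank ℝ (affineSpan ℝ s).direction : ℤ) else -1

/-- `F` is a face of the polytope `Q`. -/
def IsFaceOf (Q F : Set V) : Prop :=
  IsExtreme ℝ Q F ∧ Convex ℝ F ∧ IsClosed F

/-- `F` is a facet of the `d`-polytope `Q`. -/
def IsFacetOf (d : ℕ) (Q F : Set V) : Prop :=
  IsFaceOf Q F ∧ sdim F = (d : ℤ) - 1

/-- The segment `[a, b]` is an edge (a 1-dimensional face) of `Q`. -/
def IsEdgeOf (Q : Set V) (a b : V) : Prop :=
  IsFaceOf Q (segment ℝ a b) ∧ sdim (segment ℝ a b) = 1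

/-- Clamped vertex indexing: `x_t = x_0` for `t ≤ 0` and `x_t = x_n` for `t ≥ n`. -/
def xc {n : ℕ} (x : Fin (n + 1) → V) (t : ℤ) : V :=
  x ⟨(min (max t 0) n).toNat, by omega⟩

/-- The polytope spanned by the vertex array `x`. -/
def braxQ {n : ℕ} (x : Fin (n + 1) → V) : Set V :=
  convexHull ℝ (Set.range x)

/-- Vertex set of the simplex facet `T_i = [x_i, …, x_{i+d-1}]`. -/
def Tset (d : ℕ) {n : ℕ} (x : Fin (n + 1) → V) (i : ℤ) : Set V :=
  xc x '' Set.Icc i (i + (d : ℤ) - 1)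

/-- Vertex set of the facet
`E_j = [x_0, x_{j-(d-2)}, …, x_{j-1}, x_{j+1}, …, x_{j+(d-2)}]`. -/
def Eset (d : ℕ) {n : ℕ} (x : Fin (n + 1) → V) (j : ℤ) : Set V :=
  insert (x 0) (xc x '' (Set.Icc (j - ((d : ℤ) - 2)) (j + ((d : ℤ) - 2)) \ {j}))

/-- `x_0 < x_1 < ⋯ < x_n` is the vertex array of a `d`-braxtope: for `d ≤ 2` a
`d`-simplex; for `d ≥ 3` a `d`-polytope whose facets are exactly the `T_i`
(`0 ≤ i ≤ n - d + 1`) and the `E_j` (`2 ≤ j ≤ n`). -/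
def IsBraxtope (d n : ℕ) (x : Fin (n + 1) → V) : Prop :=
  (d ≤ 2 → n = d ∧ AffineIndependent ℝ x) ∧
  (3 ≤ d →
    d ≤ n ∧ Function.Injective x ∧
    sdim (braxQ x) = d ∧
    (∀ i, x i ∈ Set.extremePoints ℝ (braxQ x)) ∧
    (∀ F : Set V, IsFacetOf d (braxQ x) F ↔
      (∃ i : ℤ, 0 ≤ i ∧ i ≤ (n : ℤ) - d + 1 ∧ F = convexHull ℝ (Tset d x i)) ∨
      (∃ j : ℤ, 2 ≤ j ∧ j ≤ (n : ℤ) ∧ F = convexHull ℝ (Eset d x j))))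



lemma farkas_fin {W : Type*} [AddCommGroup W] [Module ℝ W] {ι : Type*} [DecidableEq ι]
    (s : Finset ι) : ∀ (u : ι → W) (b : W),
    (∃ c : ι → ℝ, (∀ i ∈ s, 0 ≤ c i) ∧ b = ∑ i ∈ s, c i • u i) ∨
    ∃ φ : W →ₗ[ℝ] ℝ, (∀ i ∈ s, 0 ≤ φ (u i)) ∧ φ b < 0 := by
  induction s using Finset.induction_on with
  | empty =>
    intro u b
    by_cases hb : b = 0
    · left; exact ⟨0, by simp, by simp [hb]⟩
    · right
      have hb' : b ∉ (⊥ : Submodule ℝ W) := by simpa using hb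
      obtain ⟨f, hf, -⟩ := Submodule.exists_le_ker_of_notMem hb'
      rcases lt_or_gt_of_ne hf with h | h
      · exact ⟨f, by simp, h⟩
      · exact ⟨-f, by simp, by simpa using h⟩
  | insert a s ha ih =>
    intro u b
    rcases ih u b with ⟨c, hc, hb⟩ | ⟨φ, hφ, hφb⟩
    · left
      refine ⟨Function.update c a 0, ?_, ?_⟩
      · intro i hi
        by_cases h : i = a
        · simp [h]
        · rw [Function.update_of_ne h]; exact hc i (by simpa [h] using hi)
      · rw [Finset.sum_insert ha, hb]
        simp only [Function.update_self, zero_smul, zero_add]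
        refine Finset.sum_congr rfl fun i hi => ?_
        rw [Function.update_of_ne (by rintro rfl; exact ha hi)]
    · by_cases hua : 0 ≤ φ (u a)
      · right
        refine ⟨φ, ?_, hφb⟩
        intro i hi
        rcases Finset.mem_insert.1 hi with rfl | h
        · exact hua
        · exact hφ i h
      · push Not at hua
        let P : W →ₗ[ℝ] W := LinearMap.id - (((φ (u a))⁻¹ • φ).smulRight (u a))
        have hP : ∀ w, P w = w - ((φ (u a))⁻¹ * φ w) • u a := fun w => by simp [P]
        rcases ih (fun i => P (u i)) (P b) with ⟨c, hc, hb⟩ | ⟨ψ, hψ, hψb⟩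
        · left
          have hs : 0 ≤ ∑ i ∈ s, c i * φ (u i) :=
            Finset.sum_nonneg fun i hi => mul_nonneg (hc i hi) (hφ i hi)
          have hinv : (φ (u a))⁻¹ < 0 := inv_lt_zero.2 hua
          refine ⟨Function.update c a ((φ (u a))⁻¹ * (φ b - ∑ i ∈ s, c i * φ (u i))), ?_, ?_⟩
          · intro i hi
            by_cases h : i = a
            · subst h
              rw [Function.update_self]
              exact mul_nonneg_of_nonpos_of_nonpos hinv.le (by linarith)
            · rw [Function.update_of_ne h]; exact hc i (by simpa [h] using hi)
          · rw [Finset.sum_insert ha, Function.update_self]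
            have h1 : ∑ i ∈ s, Function.update c a ((φ (u a))⁻¹ * (φ b - ∑ i ∈ s, c i * φ (u i))) i • u i
                = ∑ i ∈ s, c i • u i := by
              refine Finset.sum_congr rfl fun i hi => ?_
              rw [Function.update_of_ne (by rintro rfl; exact ha hi)]
            rw [h1]
            have h2 : ∑ i ∈ s, c i • P (u i) = P (∑ i ∈ s, c i • u i) := by simp [map_sum]
            rw [h2, hP, hP] at hb
            have h3 : φ (∑ i ∈ s, c i • u i) = ∑ i ∈ s, c i * φ (u i) := by simp [map_sum]
            rw [h3] at hb
            rw [sub_eq_iff_eq_add] at hb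
            calc b = _ := hb
              _ = _ := by module
        · right
          refine ⟨ψ ∘ₗ P, ?_, hψb⟩
          intro i hi
          rcases Finset.mem_insert.1 hi with rfl | h
          · have : P (u i) = 0 := by rw [hP, inv_mul_cancel₀ hua.ne, one_smul, sub_self]
            simp [this]
          · exact hψ i h

/-- Rotating a supporting hyperplane until it is spanned by the points on it. -/
lemma rotate_functional {W : Type*} [AddCommGroup W] [Module ℝ W] {ι : Type*} [Fintype ι]
    (u : ι → W) (k : ι) (φ₀ : W →ₗ[ℝ] ℝ) (h0 : ∀ i, 0 ≤ φ₀ (u i)) (hk : 0 < φ₀ (u k)) :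
    ∃ φ : W →ₗ[ℝ] ℝ, (∀ i, 0 ≤ φ (u i)) ∧ 0 < φ (u k) ∧ (∀ i, φ₀ (u i) = 0 → φ (u i) = 0) ∧
      Submodule.span ℝ (u '' {i | φ (u i) = 0}) ⊔ Submodule.span ℝ {u k} =
        Submodule.span ℝ (Set.range u) := by
  classical
  -- induct on the number of nonzero values
  generalize hN : (Finset.univ.filter fun i => φ₀ (u i) ≠ 0).card = N
  induction N using Nat.strong_induction_on generalizing φ₀ with
  | _ N ih =>
  set U := Submodule.span ℝ (u '' {i | φ₀ (u i) = 0}) ⊔ Submodule.span ℝ {u k} with hU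
  by_cases hall : ∀ i, u i ∈ U
  · refine ⟨φ₀, h0, hk, fun _ h => h, le_antisymm ?_ ?_⟩
    · refine sup_le (Submodule.span_mono (Set.image_subset_range _ _)) (Submodule.span_mono ?_)
      simp
    · rw [Submodule.span_le]; rintro _ ⟨i, rfl⟩; exact hall i
  · push Not at hall
    obtain ⟨a, ha⟩ := hall
    obtain ⟨ψ, hψa, hψU⟩ : ∃ ψ : W →ₗ[ℝ] ℝ, ψ (u a) < 0 ∧ U ≤ LinearMap.ker ψ := by
      obtain ⟨f, hf, hle⟩ := Submodule.exists_le_ker_of_notMem ha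
      rcases lt_or_gt_of_ne hf with h | h
      · exact ⟨f, h, hle⟩
      · refine ⟨-f, by simpa using h, fun w hw => ?_⟩
        have := hle hw
        simpa using this
    have hψz : ∀ i, φ₀ (u i) = 0 → ψ (u i) = 0 := fun i hi => by
      have : u i ∈ U := Submodule.mem_sup_left (Submodule.subset_span ⟨i, hi, rfl⟩)
      exact hψU this
    have hψk : ψ (u k) = 0 := by
      have : u k ∈ U := Submodule.mem_sup_right (Submodule.subset_span rfl)
      exact hψU this
    obtain ⟨m, hm, hmin⟩ := Finset.exists_min_image (Finset.univ.filter fun i => ψ (u i) < 0)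
      (fun i => φ₀ (u i) / (-ψ (u i))) ⟨a, by simpa using hψa⟩
    have hm' : ψ (u m) < 0 := by simpa using hm
    set t := φ₀ (u m) / (-ψ (u m)) with ht
    have ht0 : 0 ≤ t := div_nonneg (h0 m) (by linarith)
    have hφm : φ₀ (u m) ≠ 0 := fun h => by have := hψz m h; linarith
    have hnew0 : ∀ i, 0 ≤ (φ₀ + t • ψ) (u i) := by
      intro i
      simp only [LinearMap.add_apply, LinearMap.smul_apply, smul_eq_mul]
      by_cases hi : ψ (u i) < 0
      · have := hmin i (by simpa using hi)
        rw [le_div_iff₀ (by linarith)] at this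
        linarith
      · push Not at hi
        have := mul_nonneg ht0 hi
        have := h0 i
        linarith
    have hnewz : ∀ i, φ₀ (u i) = 0 → (φ₀ + t • ψ) (u i) = 0 := by
      intro i hi; simp [hi, hψz i hi]
    have hnewm : (φ₀ + t • ψ) (u m) = 0 := by
      simp only [LinearMap.add_apply, LinearMap.smul_apply, smul_eq_mul, ht]
      have : ψ (u m) ≠ 0 := hm'.ne
      field_simp
      ring
    obtain ⟨φ, h1, h2, h3, h4⟩ := ih _ (by
      rw [← hN]
      apply Finset.card_lt_card
      rw [Finset.ssubset_iff_of_subset]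
      · exact ⟨m, by simpa using hφm, by simpa using hnewm⟩
      · intro i hi
        simp only [Finset.mem_filter, Finset.mem_univ, true_and] at hi ⊢
        exact fun h => hi (hnewz i h)) (φ₀ + t • ψ) hnew0 (by simpa [hψk] using hk) rfl
    exact ⟨φ, h1, h2, fun i hi => h3 i (hnewz i hi), h4⟩

/-- An extreme set containing a convex combination contains the points of positive weight. -/
lemma extreme_mem_of_sum {Q F : Set V} (hQ : Convex ℝ Q) (hF : IsExtreme ℝ Q F)
    {ι : Type*} (s : Finset ι) (w : ι → ℝ) (z : ι → V) (hw : ∀ i ∈ s, 0 ≤ w i)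
    (h1 : ∑ i ∈ s, w i = 1) (hz : ∀ i ∈ s, z i ∈ Q) (hmem : ∑ i ∈ s, w i • z i ∈ F)
    (k : ι) (hk : k ∈ s) (hpos : 0 < w k) : z k ∈ F := by
  classical
  have e1 := Finset.add_sum_erase s w hk
  have e2 := Finset.add_sum_erase s (fun i => w i • z i) hk
  have hnn : ∀ i ∈ s.erase k, 0 ≤ w i := fun i hi => hw i (Finset.mem_of_mem_erase hi)
  rcases (Finset.sum_nonneg hnn).eq_or_lt with h0 | h0
  · have hall := (Finset.sum_eq_zero_iff_of_nonneg hnn).1 h0.symm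
    have : ∑ i ∈ s.erase k, w i • z i = 0 := Finset.sum_eq_zero fun i hi => by simp [hall i hi]
    rw [← e2, this, show w k = 1 by linarith] at hmem
    simpa using hmem
  · set r := ∑ i ∈ s.erase k, w i with hr
    have hy : (s.erase k).centerMass w z ∈ Q :=
      hQ.centerMass_mem hnn h0 fun i hi => hz i (Finset.mem_of_mem_erase hi)
    refine hF.left_mem_of_mem_openSegment (hz k hk) hy hmem ⟨w k, r, hpos, h0, by linarith, ?_⟩
    rw [Finset.centerMass, ← hr, smul_inv_smul₀ h0.ne', e2]

lemma mem_hull_fin {ι : Type*} [Fintype ι] {x : ι → V} {y : V}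
    (hy : y ∈ convexHull ℝ (Set.range x)) :
    ∃ w : ι → ℝ, (∀ i, 0 ≤ w i) ∧ ∑ i, w i = 1 ∧ ∑ i, w i • x i = y := by
  rw [convexHull_range_eq_exists_affineCombination] at hy
  obtain ⟨s, w, h0, h1, rfl⟩ := hy
  classical
  refine ⟨fun i => if i ∈ s then w i else 0, ?_, ?_, ?_⟩
  · intro i; dsimp; split_ifs with h
    · exact h0 i h
    · exact le_rfl
  · simpa using h1
  · rw [Finset.affineCombination_eq_linear_combination _ _ _ h1]
    simp [ite_smul]

lemma face_eq_hull {ι : Type*} [Fintype ι] {x : ι → V} {F : Set V}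
    (hF : IsFaceOf (convexHull ℝ (Set.range x)) F) :
    F = convexHull ℝ (x '' {i | x i ∈ F}) := by
  apply Set.Subset.antisymm
  · intro y hy
    obtain ⟨w, h0, h1, rfl⟩ := mem_hull_fin (hF.1.subset hy)
    have key := extreme_mem_of_sum (convex_convexHull ℝ _) hF.1 Finset.univ w x (fun i _ => h0 i) h1
      (fun i _ => subset_convexHull ℝ _ ⟨i, rfl⟩) hy
    classical
    have : ∑ i, w i • x i = ∑ i ∈ Finset.univ.filter (fun i => w i ≠ 0), w i • x i := by
      rw [Finset.sum_filter]; exact Finset.sum_congr rfl fun i _ => by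
        by_cases h : w i = 0 <;> simp [h]
    rw [this]
    refine (convex_convexHull ℝ _).sum_mem (fun i _ => h0 i) ?_ ?_
    · rw [Finset.sum_filter_ne_zero, h1]
    · intro i hi
      apply subset_convexHull ℝ _
      refine ⟨i, ?_, rfl⟩
      have hi' : w i ≠ 0 := by simpa using hi
      exact key i (Finset.mem_univ _) (lt_of_le_of_ne (h0 i) (Ne.symm hi'))
  · apply convexHull_min _ hF.2.1
    rintro _ ⟨i, hi, rfl⟩; exact hi

/-- A nonnegative affine functional exposes a face. -/
lemma exposed_face {ι : Type*} [Fintype ι] (x : ι → V) (p : V) (φ : V →ₗ[ℝ] ℝ)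
    (h0 : ∀ i, 0 ≤ φ (x i - p)) :
    IsFaceOf (convexHull ℝ (Set.range x)) (convexHull ℝ (x '' {i | φ (x i - p) = 0})) := by
  set Q := convexHull ℝ (Set.range x)
  have hge : ∀ y ∈ Q, φ p ≤ φ y := by
    intro y hy
    have : Q ⊆ {y | φ p ≤ φ y} := by
      apply convexHull_min
      · rintro _ ⟨i, rfl⟩; have := h0 i; rw [map_sub] at this; simpa using this
      · exact convex_halfSpace_ge φ.isLinear _
    exact this hy
  have hext : IsExtreme ℝ Q (Q ∩ {y | φ y = φ p}) := by
    refine ⟨Set.inter_subset_left, ?_⟩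
    rintro a ha b hb c ⟨hc, hc'⟩ ⟨s, t, hs, ht, hst, rfl⟩
    refine ⟨ha, ?_⟩
    have h1 := hge a ha
    have h2 := hge b hb
    simp only [Set.mem_ofPred_eq, map_add, map_smul, smul_eq_mul] at hc' ⊢
    have : φ p = s * φ p + t * φ p := by rw [← add_mul, hst, one_mul]
    nlinarith
  have hcl : ∀ s : Set ι, IsClosed (convexHull ℝ (x '' s)) := fun s =>
    (((Set.toFinite s).image x).isCompact_convexHull ℝ).isClosed
  have hconv : Convex ℝ (Q ∩ {y | φ y = φ p}) :=
    (convex_convexHull ℝ _).inter (convex_hyperplane φ.isLinear _)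
  have heq : Q ∩ {y | φ y = φ p} = convexHull ℝ (x '' {i | φ (x i - p) = 0}) := by
    apply Set.Subset.antisymm
    · rintro y ⟨hy, hy'⟩
      obtain ⟨w, hw0, h1, rfl⟩ := mem_hull_fin hy
      have key := extreme_mem_of_sum (convex_convexHull ℝ _) hext Finset.univ w x
        (fun i _ => hw0 i) h1 (fun i _ => subset_convexHull ℝ _ ⟨i, rfl⟩) ⟨hy, hy'⟩
      classical
      have : ∑ i, w i • x i = ∑ i ∈ Finset.univ.filter (fun i => w i ≠ 0), w i • x i := by
        rw [Finset.sum_filter]; exact Finset.sum_congr rfl fun i _ => by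
          by_cases h : w i = 0 <;> simp [h]
      rw [this]
      refine (convex_convexHull ℝ _).sum_mem (fun i _ => hw0 i) ?_ ?_
      · rw [Finset.sum_filter_ne_zero, h1]
      · intro i hi
        apply subset_convexHull ℝ _
        refine ⟨i, ?_, rfl⟩
        have hi' : w i ≠ 0 := by simpa using hi
        have := (key i (Finset.mem_univ _) (lt_of_le_of_ne (hw0 i) (Ne.symm hi'))).2
        simpa [sub_eq_zero] using this
    · apply convexHull_min _ hconv
      rintro _ ⟨i, hi, rfl⟩
      refine ⟨subset_convexHull ℝ _ ⟨i, rfl⟩, ?_⟩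
      simpa [sub_eq_zero] using hi
  rw [← heq]
  exact ⟨hext, hconv, heq ▸ hcl _⟩

lemma sdim_hull (s : Set V) : sdim (convexHull ℝ s) = sdim s := by
  unfold sdim
  rw [convexHull_nonempty_iff, affineSpan_convexHull]

lemma vectorSpan_eq_span_sub {ι : Type*} (x : ι → V) (Z : Set ι) (p : V)
    (hp : p ∈ affineSpan ℝ (x '' Z)) :
    (affineSpan ℝ (x '' Z)).direction = Submodule.span ℝ ((fun i => x i - p) '' Z) := by
  rw [← affineSpan_insert_eq_affineSpan ℝ hp, direction_affineSpan,
    vectorSpan_eq_span_vsub_set_right ℝ (Set.mem_insert p (x '' Z)), Set.image_insert_eq]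
  simp only [vsub_eq_sub, sub_self, Submodule.span_insert_zero]
  rw [Set.image_image]

lemma finrank_sup_single {W : Type*} [AddCommGroup W] [Module ℝ W] (U : Submodule ℝ W)
    [FiniteDimensional ℝ U] (v : W) (hv : v ∉ U) :
    Module.finrank ℝ (U ⊔ Submodule.span ℝ {v} : Submodule ℝ W) = Module.finrank ℝ U + 1 := by
  have h0 : v ≠ 0 := fun h => hv (h ▸ U.zero_mem)
  have h := Submodule.finrank_sup_add_finrank_inf_eq U (Submodule.span ℝ {v})
  have hd : U ⊓ Submodule.span ℝ {v} = ⊥ := by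
    rw [← disjoint_iff, Submodule.disjoint_span_singleton' h0]; exact hv
  rw [hd, finrank_bot, finrank_span_singleton h0] at h
  exact h

lemma exists_facet {ι : Type*} [Fintype ι] (d : ℕ) (x : ι → V)
    (hdim : sdim (convexHull ℝ (Set.range x)) = d) (F : Set V)
    (hF : IsFaceOf (convexHull ℝ (Set.range x)) F) (hne : F.Nonempty) (k : ι) (hk : x k ∉ F) :
    ∃ G, IsFacetOf d (convexHull ℝ (Set.range x)) G ∧ F ⊆ G ∧ x k ∉ G := by
  classical
  set S : Finset ι := Finset.univ.filter fun i => x i ∈ F with hS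
  have hFS := face_eq_hull hF
  have hSne : S.Nonempty := by
    rw [hFS, convexHull_nonempty_iff] at hne
    obtain ⟨_, i, hi, -⟩ := hne
    exact ⟨i, by simpa [hS] using hi⟩
  have hSc : (0 : ℝ) < S.card := by exact_mod_cast hSne.card_pos
  set p : V := ∑ i ∈ S, ((S.card : ℝ)⁻¹) • x i with hp
  have hpF : p ∈ F := by
    refine hF.2.1.sum_mem (fun i _ => inv_nonneg.2 hSc.le) ?_ ?_
    · simp [hSc.ne']
    · intro i hi; exact (Finset.mem_filter.1 hi).2
  have hsum0 : ∑ i ∈ S, (x i - p) = 0 := by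
    rw [Finset.sum_sub_distrib, hp, ← Finset.smul_sum, Finset.sum_const, ← Nat.cast_smul_eq_nsmul ℝ,
      smul_inv_smul₀ hSc.ne', sub_self]
  obtain ⟨φ₀, h0, h0k, h0S⟩ : ∃ φ : V →ₗ[ℝ] ℝ, (∀ i, 0 ≤ φ (x i - p)) ∧ 0 < φ (x k - p) ∧
      ∀ i, x i ∈ F → φ (x i - p) = 0 := by
    rcases farkas_fin Finset.univ (fun i => x i - p) (-(x k - p)) with ⟨c, hc, hb⟩ | ⟨φ, hφ, hb⟩
    · exfalso
      apply hk
      have hc' : ∀ i, 0 ≤ c i := fun i => hc i (Finset.mem_univ _)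
      set r := 1 + ∑ i, c i with hr
      have hr0 : 0 < r := by have := Finset.sum_nonneg hc; linarith
      set w : ι → ℝ := fun i => r⁻¹ * (c i + if i = k then 1 else 0) with hw
      have hw1 : ∑ i, w i = 1 := by
        rw [hw, ← Finset.mul_sum, Finset.sum_add_distrib]
        simp only [Finset.sum_ite_eq', Finset.mem_univ, if_true]
        rw [add_comm, ← hr, inv_mul_cancel₀ hr0.ne']
      have hwp : ∑ i, w i • x i = p := by
        have e : ∑ i, (c i + if i = k then (1:ℝ) else 0) • (x i - p) = 0 := by
          simp only [add_smul, Finset.sum_add_distrib, ite_smul, one_smul, zero_smul,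
            Finset.sum_ite_eq', Finset.mem_univ, if_true]
          rw [← hb]; simp
        have e2 : ∑ i, w i • (x i - p) = 0 := by
          simp only [hw, mul_smul]
          rw [← Finset.smul_sum, e, smul_zero]
        simp only [smul_sub, Finset.sum_sub_distrib] at e2
        rw [← Finset.sum_smul, hw1, one_smul, sub_eq_zero] at e2
        exact e2
      refine extreme_mem_of_sum (convex_convexHull ℝ _) hF.1 Finset.univ w x ?_ hw1
        (fun i _ => subset_convexHull ℝ _ ⟨i, rfl⟩) (hwp ▸ hpF) k (Finset.mem_univ _) ?_
      · intro i _
        have := hc' i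
        simp only [hw]
        split_ifs <;> positivity
      · have := hc' k
        simp only [hw, if_true]
        positivity
    · refine ⟨φ, fun i => hφ i (Finset.mem_univ _), by simpa using hb, ?_⟩
      intro i hi
      have : ∑ i ∈ S, φ (x i - p) = 0 := by rw [← map_sum, hsum0, map_zero]
      exact (Finset.sum_eq_zero_iff_of_nonneg fun i _ => hφ i (Finset.mem_univ _)).1 this i
        (by simpa [hS] using hi)
  obtain ⟨φ, h1, h2, h3, h4⟩ := rotate_functional (fun i => x i - p) k φ₀ h0 h0k
  set Z : Set ι := {i | φ (x i - p) = 0} with hZ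
  have hFG : F ⊆ convexHull ℝ (x '' Z) := by
    rw [hFS]
    apply convexHull_mono
    apply Set.image_mono
    intro i hi
    exact h3 i (h0S i hi)
  have hpa : ∀ {s : Set V}, p ∈ convexHull ℝ s → p ∈ affineSpan ℝ s :=
    fun h => convexHull_subset_affineSpan _ h
  have hpG : p ∈ affineSpan ℝ (x '' Z) := hpa (hFG hpF)
  have hpQ : p ∈ affineSpan ℝ (x '' Set.univ) := by
    rw [Set.image_univ]; exact hpa (hF.1.subset hpF)
  refine ⟨convexHull ℝ (x '' Z), ⟨exposed_face x p φ h1, ?_⟩, hFG, ?_⟩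
  · have hZne : (x '' Z).Nonempty := by
      rw [← convexHull_nonempty_iff (𝕜 := ℝ)]; exact ⟨p, hFG hpF⟩
    have hQne : (Set.range x).Nonempty := ⟨x k, k, rfl⟩
    rw [sdim_hull, sdim, if_pos hQne, ← Set.image_univ, vectorSpan_eq_span_sub x _ p hpQ,
      Set.image_univ, ← h4] at hdim
    rw [sdim_hull, sdim, if_pos hZne, vectorSpan_eq_span_sub x _ p hpG]
    have : FiniteDimensional ℝ (Submodule.span ℝ ((fun i => x i - p) '' Z)) :=
      FiniteDimensional.span_of_finite ℝ ((Set.toFinite Z).image _)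
    rw [finrank_sup_single] at hdim
    · rw [← hdim]; push_cast; ring
    · intro hmem
      have : Submodule.span ℝ ((fun i => x i - p) '' Z) ≤ LinearMap.ker φ := by
        rw [Submodule.span_le]; rintro _ ⟨i, hi, rfl⟩; exact hi
      have := this hmem
      rw [LinearMap.mem_ker] at this
      exact h2.ne' this
  · intro hmem
    have : convexHull ℝ (x '' Z) ⊆ {y | φ y = φ p} := by
      apply convexHull_min _ (convex_hyperplane φ.isLinear _)
      rintro _ ⟨i, hi, rfl⟩
      have hi' : φ (x i - p) = 0 := hi
      rw [map_sub, sub_eq_zero] at hi'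
      exact hi'
    have h := this hmem
    have h' : φ (x k) = φ p := h
    rw [map_sub, h', sub_self] at h2
    exact lt_irrefl _ h2

lemma hull_image_closed {ι : Type*} [Finite ι] (x : ι → V) (s : Set ι) :
    IsClosed (convexHull ℝ (x '' s)) :=
  (((Set.toFinite s).image x).isCompact_convexHull ℝ).isClosed

lemma mem_of_mem_hull {ι : Type*} {x : ι → V} (hinj : Function.Injective x)
    (hext : ∀ i, x i ∈ Set.extremePoints ℝ (convexHull ℝ (Set.range x))) {A : Set ι} {i : ι}
    (h : x i ∈ convexHull ℝ (x '' A)) : i ∈ A := by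
  have h1 : x i ∈ (convexHull ℝ (x '' A)).extremePoints ℝ :=
    inter_extremePoints_subset_extremePoints_of_subset
      (convexHull_mono (Set.image_subset_range _ _)) ⟨h, hext i⟩
  obtain ⟨j, hj, hji⟩ := extremePoints_convexHull_subset h1
  rwa [← hinj hji]

lemma IsFaceOf.trans' {Q F G : Set V} (h : IsFaceOf Q F) (h' : IsFaceOf F G) : IsFaceOf Q G :=
  ⟨h.1.trans h'.1, h'.2⟩

lemma sdim_singleton (y : V) : sdim ({y} : Set V) = 0 := by
  simp [sdim, direction_affineSpan]

lemma face_dim_zero {ι : Type*} [Fintype ι] {x : ι → V}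
    (hext : ∀ i, x i ∈ Set.extremePoints ℝ (convexHull ℝ (Set.range x))) (F : Set V) :
    (IsFaceOf (convexHull ℝ (Set.range x)) F ∧ sdim F = 0) ↔ ∃ i, F = {x i} := by
  constructor
  · rintro ⟨hF, h0⟩
    have hFS := face_eq_hull hF
    have hne : F.Nonempty := by
      by_contra h; simp [sdim, h] at h0
    have hne2 := hne
    rw [hFS, convexHull_nonempty_iff] at hne2
    obtain ⟨_, i, hi, -⟩ := hne2
    refine ⟨i, ?_⟩
    rw [sdim, if_pos hne] at h0
    have : FiniteDimensional ℝ (affineSpan ℝ F).direction := by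
      rw [hFS, affineSpan_convexHull]
      exact finiteDimensional_direction_affineSpan_of_finite ℝ ((Set.toFinite _).image x)
    have hb : (affineSpan ℝ F).direction = ⊥ := by
      rw [← Submodule.finrank_eq_zero (R := ℝ)]; exact_mod_cast h0
    apply Set.Subset.antisymm
    · intro y hy
      have := AffineSubspace.vsub_mem_direction (subset_affineSpan ℝ F hy)
        (subset_affineSpan ℝ F hi)
      rw [hb, Submodule.mem_bot, vsub_eq_sub, sub_eq_zero] at this
      exact this
    · rintro _ rfl; exact hi
  · rintro ⟨i, rfl⟩
    exact ⟨⟨isExtreme_singleton.2 (hext i), convex_singleton _, isClosed_singleton⟩, sdim_singleton _⟩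

/-- a hull of an affinely independent set of size `m + 1` has dimension `m` -/
lemma sdim_affineIndep {ι : Type*} {x : ι → V} (A : Finset ι) (hA : A.Nonempty)
    (hi : AffineIndependent ℝ fun i : A => x i) :
    sdim (convexHull ℝ (x '' (A : Set ι))) = A.card - 1 := by
  obtain ⟨a, ha⟩ := hA
  rw [sdim_hull, sdim, if_pos ⟨x a, a, ha, rfl⟩, direction_affineSpan]
  have hr : x '' (A : Set ι) = Set.range (fun i : A => x i) := by
    ext y; simp
  have hc : Fintype.card A = (A.card - 1) + 1 := by
    have : 0 < A.card := Finset.card_pos.2 ⟨a, ha⟩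
    simp; omega
  rw [hr, hi.finrank_vectorSpan hc]
  have : 0 < A.card := Finset.card_pos.2 ⟨a, ha⟩
  omega

lemma affineIndep_of_sdim {ι : Type*} {x : ι → V} (A : Finset ι) (hA : A.Nonempty)
    (h : sdim (convexHull ℝ (x '' (A : Set ι))) = A.card - 1) :
    AffineIndependent ℝ fun i : A => x i := by
  obtain ⟨a, ha⟩ := hA
  rw [sdim_hull, sdim, if_pos ⟨x a, a, ha, rfl⟩, direction_affineSpan] at h
  have hr : x '' (A : Set ι) = Set.range (fun i : A => x i) := by
    ext y; simp
  have hp : 0 < A.card := Finset.card_pos.2 ⟨a, ha⟩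
  have hc : Fintype.card A = (A.card - 1) + 1 := by
    simp; omega
  rw [affineIndependent_iff_finrank_vectorSpan_eq ℝ _ hc, ← hr]
  omega

lemma sdim_le_card {ι : Type*} {x : ι → V} (A : Finset ι) :
    sdim (convexHull ℝ (x '' (A : Set ι))) ≤ A.card - 1 := by
  classical
  rcases A.eq_empty_or_nonempty with rfl | hA
  · simp [sdim]
  · obtain ⟨a, ha⟩ := hA
    have hp : 0 < A.card := Finset.card_pos.2 ⟨a, ha⟩
    rw [sdim_hull, sdim, if_pos ⟨x a, a, ha, rfl⟩, direction_affineSpan]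
    have := finrank_vectorSpan_image_finset_le ℝ x A (n := A.card - 1) (by omega)
    rw [Finset.coe_image] at this
    omega

lemma simplex_subface {ι : Type*} {x : ι → V} (A B : Finset ι)
    (hAB : A ⊆ B) (hA : A.Nonempty) (hi : AffineIndependent ℝ fun i : B => x i) :
    IsFaceOf (convexHull ℝ (x '' (B : Set ι))) (convexHull ℝ (x '' (A : Set ι))) := by
  classical
  obtain ⟨a, ha⟩ := hA
  have hli := (affineIndependent_iff_linearIndependent_vsub ℝ (fun i : B => x i) ⟨a, hAB ha⟩).1 hi
  obtain ⟨φ, hφ⟩ := LinearMap.exists_extend ((Module.Basis.span hli).constr ℝ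
    (fun i => if (i : B).1 ∈ A then (0 : ℝ) else 1))
  have hval : ∀ i : B, φ (x i - x a) = if i.1 ∈ A then (0:ℝ) else 1 := by
    intro i
    by_cases hia : i = ⟨a, hAB ha⟩
    · subst hia; simp [ha]
    · have h1 := congrArg (fun f => f ((Module.Basis.span hli) ⟨i, hia⟩)) hφ
      simp only [LinearMap.comp_apply, Module.Basis.constr_basis] at h1
      rw [Submodule.subtype_apply, Module.Basis.span_apply] at h1
      exact h1
  have := exposed_face (fun i : B => x i) (x a) φ (fun i => by rw [hval]; split_ifs <;> simp)
  have e1 : Set.range (fun i : B => x i) = x '' (B : Set ι) := by ext y; simp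
  have e2 : (fun i : B => x i) '' {i | φ (x i - x a) = 0} = x '' (A : Set ι) := by
    ext y
    constructor
    · rintro ⟨i, hi, rfl⟩
      have hi' : φ (x i - x a) = 0 := hi
      rw [hval] at hi'
      by_cases h : i.1 ∈ A
      · exact ⟨i, h, rfl⟩
      · simp [h] at hi'
    · rintro ⟨i, hi, rfl⟩
      refine ⟨⟨i, hAB hi⟩, ?_, rfl⟩
      show φ (x i - x a) = 0
      have := hval ⟨i, hAB hi⟩
      simp only at this
      rw [this, if_pos (Finset.mem_coe.1 hi)]
  rw [e1, e2] at this
  exact this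

lemma wbtw_extreme {Q : Set V} {a b c : V} (ha : a ∈ Q) (hc : c ∈ Q)
    (hb : b ∈ Set.extremePoints ℝ Q) (h : Wbtw ℝ a b c) : a = b ∨ c = b :=
  (mem_extremePoints_iff_forall_segment.1 hb).2 a ha c hc ((mem_segment_iff_wbtw).2 h)

lemma face_dim_one {ι : Type*} [Fintype ι] {x : ι → V} (hinj : Function.Injective x)
    (hext : ∀ i, x i ∈ Set.extremePoints ℝ (convexHull ℝ (Set.range x))) (F : Set V)
    (hF : IsFaceOf (convexHull ℝ (Set.range x)) F) (h1 : sdim F = 1) :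
    ∃ i k, i ≠ k ∧ F = convexHull ℝ (x '' {i, k}) := by
  classical
  have hFS := face_eq_hull hF
  set S : Finset ι := Finset.univ.filter fun i => x i ∈ F with hS
  have hSF : F = convexHull ℝ (x '' (S : Set ι)) := by
    rw [hFS]; congr 2; ext i; simp [hS]
  have hcard : 2 ≤ S.card := by
    have := sdim_le_card (x := x) S
    rw [← hSF, h1] at this; omega
  have hle : S.card ≤ 2 := by
    by_contra hlt
    push Not at hlt
    obtain ⟨a, ha, b, hb, c, hc, hab, hac, hbc⟩ := Finset.two_lt_card.1 hlt
    have hcol : Collinear ℝ (x '' (S : Set ι)) := by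
      have : FiniteDimensional ℝ (vectorSpan ℝ (x '' (S : Set ι))) :=
        finiteDimensional_vectorSpan_of_finite ℝ ((Set.toFinite _).image x)
      rw [collinear_iff_finrank_le_one]
      rw [hSF, sdim_hull, sdim, if_pos ⟨x a, a, ha, rfl⟩, direction_affineSpan] at h1
      omega
    have hcol3 : Collinear ℝ ({x a, x b, x c} : Set V) := by
      apply hcol.subset
      rintro y (rfl | rfl | rfl)
      · exact ⟨a, ha, rfl⟩
      · exact ⟨b, hb, rfl⟩
      · exact ⟨c, hc, rfl⟩
    have hQ : ∀ i, x i ∈ convexHull ℝ (Set.range x) := fun i => (hext i).1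
    rcases hcol3.wbtw_or_wbtw_or_wbtw with h | h | h
    · rcases wbtw_extreme (hQ a) (hQ c) (hext b) h with h | h
      · exact hab (hinj h)
      · exact hbc (hinj h).symm
    · rcases wbtw_extreme (hQ b) (hQ a) (hext c) h with h | h
      · exact hbc (hinj h)
      · exact hac (hinj h)
    · rcases wbtw_extreme (hQ c) (hQ b) (hext a) h with h | h
      · exact hac (hinj h).symm
      · exact hab (hinj h).symm
  obtain ⟨i, k, hik, hSik⟩ := Finset.card_eq_two.1 (le_antisymm hle hcard)
  refine ⟨i, k, hik, ?_⟩
  rw [hSF, hSik]; simp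

lemma edge_sdim {ι : Type*} {x : ι → V} (hinj : Function.Injective x) {i k : ι} (hik : i ≠ k) :
    sdim (convexHull ℝ (x '' {i, k})) = 1 := by
  rw [sdim_hull, sdim, if_pos ⟨x i, i, by simp, rfl⟩, Set.image_pair, direction_affineSpan,
    vectorSpan_pair, vsub_eq_sub, finrank_span_singleton]
  · simp
  · rw [sub_ne_zero]; exact fun h => hik (hinj h)

/-- A two-dimensional face has no vertex with three neighbours. -/
lemma three_nbrs {ι : Type*} [Fintype ι] {x : ι → V} (hinj : Function.Injective x)
    (hext : ∀ i, x i ∈ Set.extremePoints ℝ (convexHull ℝ (Set.range x))) (F : Set V)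
    (hF : IsFaceOf (convexHull ℝ (Set.range x)) F) (h2 : sdim F = 2) (o a b c : ι)
    (ho : x o ∈ F) (ha : x a ∈ F) (hb : x b ∈ F) (hc : x c ∈ F)
    (hoa : o ≠ a) (hob : o ≠ b) (hoc : o ≠ c) (hab : a ≠ b) (hac : a ≠ c) (hbc : b ≠ c)
    (ea : IsFaceOf (convexHull ℝ (Set.range x)) (convexHull ℝ (x '' {o, a})))
    (eb : IsFaceOf (convexHull ℝ (Set.range x)) (convexHull ℝ (x '' {o, b})))
    (ec : IsFaceOf (convexHull ℝ (Set.range x)) (convexHull ℝ (x '' {o, c}))) : False := by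
  have hQ : ∀ i, x i ∈ convexHull ℝ (Set.range x) := fun i => (hext i).1
  have key : ∀ a b c : ι, o ≠ a → o ≠ b → o ≠ c → a ≠ b → a ≠ c → b ≠ c →
      IsFaceOf (convexHull ℝ (Set.range x)) (convexHull ℝ (x '' {o, c})) →
      ∀ α β γ : ℝ, 0 ≤ α → 0 ≤ β → α • (x a - x o) + β • (x b - x o) + γ • (x c - x o) = 0 →
      α = 0 ∧ β = 0 ∧ γ = 0 := by
    intro a b c hoa hob hoc hab hac hbc ec α β γ hα hβ h
    set N := α + β + |γ| + 1 with hN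
    have hN0 : 0 < N := by positivity
    have hg1 : 0 ≤ (|γ| - γ) / 2 := by have := le_abs_self γ; linarith
    have hg2 : 0 ≤ (|γ| + γ) / 2 := by have := neg_abs_le γ; linarith
    have hg3 : |γ| - γ ≤ 2 * |γ| := by have := neg_abs_le γ; linarith
    have hg4 : |γ| + γ ≤ 2 * |γ| := by have := le_abs_self γ; linarith
    have hg := abs_nonneg γ
    set w : Fin 4 → ℝ := ![1 - (α + β + (|γ| + γ) / 2) / N, α / N, β / N, ((|γ| + γ) / 2) / N] with hw
    have hw0 : ∀ i ∈ Finset.univ, 0 ≤ w i := by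
      intro i _
      fin_cases i
      · simp only [hw]
        show 0 ≤ 1 - (α + β + (|γ| + γ) / 2) / N
        rw [sub_nonneg, div_le_one hN0]; linarith
      · show 0 ≤ α / N; positivity
      · show 0 ≤ β / N; positivity
      · show 0 ≤ ((|γ| + γ) / 2) / N; positivity
    have hw1 : ∑ i, w i = 1 := by
      simp only [Fin.sum_univ_four, hw]
      simp
      ring
    have hz : ∀ i ∈ Finset.univ, (![x o, x a, x b, x c] : Fin 4 → V) i ∈ convexHull ℝ (Set.range x) := by
      intro i _
      fin_cases i
      · exact hQ o
      · exact hQ a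
      · exact hQ b
      · exact hQ c
    have hsum : ∑ i, w i • (![x o, x a, x b, x c] : Fin 4 → V) i ∈ convexHull ℝ (x '' {o, c}) := by
      have e : ∑ i, w i • (![x o, x a, x b, x c] : Fin 4 → V) i =
          (1 - ((|γ| - γ) / 2) / N) • x o + (((|γ| - γ) / 2) / N) • x c := by
        have h' := congrArg (fun v => N⁻¹ • v) h
        simp only [smul_zero] at h'
        rw [← sub_eq_zero, ← h']
        simp only [Fin.sum_univ_four, hw]
        simp
        module
      rw [e]
      have m1 : x o ∈ convexHull ℝ (x '' {o, c}) := subset_convexHull ℝ _ ⟨o, by simp, rfl⟩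
      have m2 : x c ∈ convexHull ℝ (x '' {o, c}) := subset_convexHull ℝ _ ⟨c, by simp, rfl⟩
      refine (convex_convexHull ℝ _) m1 m2 ?_ (by positivity) (by ring)
      rw [sub_nonneg, div_le_one hN0]; linarith
    have hmem := extreme_mem_of_sum (convex_convexHull ℝ _) ec.1 Finset.univ w _ hw0 hw1 hz hsum
    have hα0 : α = 0 := by
      by_contra hne
      have hpos : 0 < w 1 := by
        show 0 < α / N
        have : 0 < α := lt_of_le_of_ne hα (Ne.symm hne)
        positivity
      have h3 : x a ∈ convexHull ℝ (x '' {o, c}) := hmem 1 (Finset.mem_univ _) hpos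
      rcases mem_of_mem_hull hinj hext h3 with h | h
      · exact hoa h.symm
      · exact hac h
    have hβ0 : β = 0 := by
      by_contra hne
      have hpos : 0 < w 2 := by
        show 0 < β / N
        have : 0 < β := lt_of_le_of_ne hβ (Ne.symm hne)
        positivity
      have h3 : x b ∈ convexHull ℝ (x '' {o, c}) := hmem 2 (Finset.mem_univ _) hpos
      rcases mem_of_mem_hull hinj hext h3 with h | h
      · exact hob h.symm
      · exact hbc h
    refine ⟨hα0, hβ0, ?_⟩
    rw [hα0, hβ0, zero_smul, zero_smul, zero_add, zero_add, smul_eq_zero, sub_eq_zero] at h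
    rcases h with h | h
    · exact h
    · exact absurd (hinj h).symm hoc
  have hdep : ¬ LinearIndependent ℝ (![x a - x o, x b - x o, x c - x o] : Fin 3 → V) := by
    intro hli
    have h3 := finrank_span_eq_card hli
    rw [sdim, if_pos ⟨_, ho⟩] at h2
    have hfin : FiniteDimensional ℝ (affineSpan ℝ F).direction := by
      rw [face_eq_hull hF, affineSpan_convexHull]
      exact finiteDimensional_direction_affineSpan_of_finite ℝ ((Set.toFinite _).image x)
    have hle : Submodule.span ℝ (Set.range (![x a - x o, x b - x o, x c - x o] : Fin 3 → V)) ≤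
        (affineSpan ℝ F).direction := by
      rw [Submodule.span_le]
      rintro _ ⟨i, rfl⟩
      have hm : ∀ y ∈ F, y - x o ∈ (affineSpan ℝ F).direction := fun y hy =>
        AffineSubspace.vsub_mem_direction (subset_affineSpan ℝ F hy) (subset_affineSpan ℝ F ho)
      fin_cases i
      · exact hm _ ha
      · exact hm _ hb
      · exact hm _ hc
    have := Submodule.finrank_mono hle
    rw [h3] at this
    simp at this
    omega
  rw [Fintype.not_linearIndependent_iff] at hdep
  obtain ⟨g, hg, hne⟩ := hdep
  have hg' : g 0 • (x a - x o) + g 1 • (x b - x o) + g 2 • (x c - x o) = 0 := by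
    simpa [Fin.sum_univ_three] using hg
  -- two of the three coefficients have the same sign
  have fin : g 0 = 0 ∧ g 1 = 0 ∧ g 2 = 0 := by
    have K1 := key a b c hoa hob hoc hab hac hbc ec
    have K2 := key a c b hoa hoc hob hac hab hbc.symm eb
    have K3 := key b c a hob hoc hoa hbc hab.symm hac.symm ea
    have hn : (-g 0) • (x a - x o) + (-g 1) • (x b - x o) + (-g 2) • (x c - x o) = 0 := by
      rw [← neg_eq_zero, ← hg']; module
    rcases le_total 0 (g 0) with p0 | p0 <;> rcases le_total 0 (g 1) with p1 | p1 <;>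
      rcases le_total 0 (g 2) with p2 | p2
    · exact K1 _ _ _ p0 p1 hg'
    · exact K1 _ _ _ p0 p1 hg'
    · obtain ⟨h1, h2, h3⟩ := K2 _ _ (g 1) p0 p2 (by rw [← hg']; module); exact ⟨h1, h3, h2⟩
    · obtain ⟨h1, h2, h3⟩ := K3 _ _ (-g 0) (neg_nonneg.2 p1) (neg_nonneg.2 p2)
        (by rw [← hn]; module)
      exact ⟨by linarith, by linarith, by linarith⟩
    · obtain ⟨h1, h2, h3⟩ := K3 _ _ (g 0) p1 p2 (by rw [← hg']; module); exact ⟨h3, h1, h2⟩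
    · obtain ⟨h1, h2, h3⟩ := K2 _ _ (-g 1) (neg_nonneg.2 p0) (neg_nonneg.2 p2)
        (by rw [← hn]; module)
      exact ⟨by linarith, by linarith, by linarith⟩
    · obtain ⟨h1, h2, h3⟩ := K1 _ _ _ (neg_nonneg.2 p0) (neg_nonneg.2 p1) hn
      exact ⟨by linarith, by linarith, by linarith⟩
    · obtain ⟨h1, h2, h3⟩ := K1 _ _ _ (neg_nonneg.2 p0) (neg_nonneg.2 p1) hn
      exact ⟨by linarith, by linarith, by linarith⟩
  obtain ⟨i, hi⟩ := hne
  fin_cases i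
  · exact hi fin.1
  · exact hi fin.2.1
  · exact hi fin.2.2

lemma xc_eq {n : ℕ} (x : Fin (n + 1) → V) (t : ℤ) (m : Fin (n + 1))
    (h : min (max t 0) n = (m : ℤ)) : xc x t = x m := by
  unfold xc
  congr 1
  apply Fin.ext
  show (min (max t 0) (n : ℤ)).toNat = m
  omega

/-- index set of `T_i` -/
def TF (d n : ℕ) (i : ℤ) : Finset (Fin (n + 1)) :=
  Finset.univ.filter fun m => i ≤ (m : ℤ) ∧ (m : ℤ) ≤ i + d - 1

/-- index set of `E_j` -/
def EF (d n : ℕ) (j : ℤ) : Finset (Fin (n + 1)) :=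
  Finset.univ.filter fun m => (m : ℤ) = 0 ∨
    (j - (d - 2) ≤ (m : ℤ) ∧ (m : ℤ) ≤ j + (d - 2) ∧ ((m : ℤ) ≠ j ∨ (m : ℤ) = n))

lemma mem_TF {d n : ℕ} {i : ℤ} {m : Fin (n + 1)} :
    m ∈ TF d n i ↔ i ≤ (m : ℤ) ∧ (m : ℤ) ≤ i + d - 1 := by simp [TF]

lemma mem_EF {d n : ℕ} {j : ℤ} {m : Fin (n + 1)} :
    m ∈ EF d n j ↔ (m : ℤ) = 0 ∨
    (j - (d - 2) ≤ (m : ℤ) ∧ (m : ℤ) ≤ j + (d - 2) ∧ ((m : ℤ) ≠ j ∨ (m : ℤ) = n)) := by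
  simp [EF]

lemma Tset_eq {d n : ℕ} (x : Fin (n + 1) → V) (i : ℤ) (h0 : 0 ≤ i) (h1 : i ≤ (n : ℤ) - d + 1) :
    Tset d x i = x '' (TF d n i : Set (Fin (n + 1))) := by
  ext y
  constructor
  · rintro ⟨t, ⟨ht1, ht2⟩, rfl⟩
    refine ⟨⟨t.toNat, by omega⟩, ?_, ?_⟩
    · rw [Finset.mem_coe, mem_TF]; dsimp; omega
    · symm; apply xc_eq; dsimp; omega
  · rintro ⟨m, hm, rfl⟩
    rw [Finset.mem_coe, mem_TF] at hm
    refine ⟨m, ⟨hm.1, hm.2⟩, ?_⟩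
    apply xc_eq
    have := m.2
    omega

lemma Eset_eq {d n : ℕ} (hd : 3 ≤ d) (x : Fin (n + 1) → V) (j : ℤ) (h0 : 2 ≤ j) (h1 : j ≤ (n : ℤ)) :
    Eset d x j = x '' (EF d n j : Set (Fin (n + 1))) := by
  ext y
  constructor
  · rintro (rfl | ⟨t, ⟨⟨ht1, ht2⟩, ht3⟩, rfl⟩)
    · exact ⟨0, by rw [Finset.mem_coe, mem_EF]; simp, rfl⟩
    · have ht3' : t ≠ j := ht3
      refine ⟨⟨(min (max t 0) n).toNat, by omega⟩, ?_, ?_⟩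
      · rw [Finset.mem_coe, mem_EF]; dsimp; omega
      · symm; apply xc_eq; dsimp; omega
  · rintro ⟨m, hm, rfl⟩
    rw [Finset.mem_coe, mem_EF] at hm
    have hm2 := m.2
    rcases hm with hm | ⟨ha, hb, hc⟩
    · left
      congr 1
      apply Fin.ext
      simpa using hm
    · right
      by_cases hmj : (m : ℤ) = j
      · refine ⟨j + 1, ⟨⟨by omega, by omega⟩, ?_⟩, ?_⟩
        · intro h
          have h' : j + 1 = j := h
          omega
        · apply xc_eq; omega
      · refine ⟨m, ⟨⟨by omega, by omega⟩, hmj⟩, ?_⟩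
        apply xc_eq; omega

lemma card_TF {d n : ℕ} (i : ℤ) (h0 : 0 ≤ i) (h1 : i ≤ (n : ℤ) - d + 1) : (TF d n i).card = d := by
  have : (TF d n i).map Fin.valEmbedding = Finset.Ico i.toNat (i.toNat + d) := by
    ext m
    simp only [Finset.mem_map, mem_TF, Finset.mem_Ico]
    constructor
    · rintro ⟨a, ha, rfl⟩
      simp only [Fin.valEmbedding_apply]
      omega
    · intro h
      exact ⟨⟨m, by omega⟩, by dsimp; omega, rfl⟩
  rw [← Finset.card_map, this]; simp

section brax
variable {d n : ℕ} {x : Fin (n + 1) → V}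

lemma T_face (hd : 3 ≤ d) (hx : IsBraxtope d n x) (i : ℤ) (h0 : 0 ≤ i) (h1 : i ≤ (n : ℤ) - d + 1) :
    IsFaceOf (convexHull ℝ (Set.range x)) (convexHull ℝ (x '' (TF d n i : Set (Fin (n + 1))))) ∧
    AffineIndependent ℝ fun m : TF d n i => x m := by
  obtain ⟨hn, hinj, hdim, hext, hfac⟩ := hx.2 hd
  have hc := card_TF (d := d) i h0 h1
  have h := (hfac (convexHull ℝ (Tset d x i))).2 (Or.inl ⟨i, h0, h1, rfl⟩)
  rw [Tset_eq x i h0 h1] at h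
  refine ⟨h.1, affineIndep_of_sdim _ ?_ ?_⟩
  · rw [← Finset.card_pos, hc]; omega
  · rw [h.2, hc]

lemma E_face (hd : 3 ≤ d) (hx : IsBraxtope d n x) (j : ℤ) (h0 : 2 ≤ j) (h1 : j ≤ (n : ℤ)) :
    IsFaceOf (convexHull ℝ (Set.range x)) (convexHull ℝ (x '' (EF d n j : Set (Fin (n + 1))))) := by
  obtain ⟨hn, hinj, hdim, hext, hfac⟩ := hx.2 hd
  have h := (hfac (convexHull ℝ (Eset d x j))).2 (Or.inr ⟨j, h0, h1, rfl⟩)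
  rw [Eset_eq hd x j h0 h1] at h
  exact h.1

lemma face_in_T (hd : 3 ≤ d) (hx : IsBraxtope d n x) (F : Set V)
    (hF : IsFaceOf (convexHull ℝ (Set.range x)) F) (hne : F.Nonempty) (h0 : x 0 ∉ F) :
    ∃ i : ℤ, 0 ≤ i ∧ i ≤ (n : ℤ) - d + 1 ∧
      F ⊆ convexHull ℝ (x '' (TF d n i : Set (Fin (n + 1)))) := by
  obtain ⟨hn, hinj, hdim, hext, hfac⟩ := hx.2 hd
  obtain ⟨G, hG, hFG, h0G⟩ := exists_facet d x hdim F hF hne 0 h0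
  rcases (hfac G).1 hG with ⟨i, hi0, hi1, rfl⟩ | ⟨j, hj0, hj1, rfl⟩
  · exact ⟨i, hi0, hi1, by rw [← Tset_eq x i hi0 hi1]; exact hFG⟩
  · exact absurd (subset_convexHull ℝ _ (Set.mem_insert _ _)) h0G

lemma edge_iff (hd : 3 ≤ d) (hx : IsBraxtope d n x) (i k : Fin (n + 1)) (hik : i < k) :
    IsFaceOf (convexHull ℝ (Set.range x)) (convexHull ℝ (x '' {i, k})) ↔
      i = 0 ∨ (k : ℕ) + 1 ≤ i + d := by
  obtain ⟨hn, hinj, hdim, hext, hfac⟩ := hx.2 hd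
  have hk2 := k.2
  have hik' : (i : ℕ) < k := hik
  constructor
  · intro h
    by_contra hcon
    push Not at hcon
    obtain ⟨hi0, hfar⟩ := hcon
    have hiF : x i ∈ convexHull ℝ (x '' {i, k}) := subset_convexHull ℝ _ ⟨i, by simp, rfl⟩
    have hkF : x k ∈ convexHull ℝ (x '' {i, k}) := subset_convexHull ℝ _ ⟨k, by simp, rfl⟩
    obtain ⟨t, ht0, ht1, hsub⟩ := face_in_T hd hx _ h ⟨_, hiF⟩ (by
      intro h0
      rcases mem_of_mem_hull hinj hext h0 with h0 | h0
      · exact hi0 h0.symm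
      · have h0' : (0 : Fin (n + 1)) = k := h0
        rw [← h0'] at hik
        exact absurd hik (Fin.not_lt_zero i))
    have h1 := mem_of_mem_hull hinj hext (hsub hiF)
    have h2 := mem_of_mem_hull hinj hext (hsub hkF)
    rw [Finset.mem_coe, mem_TF] at h1 h2
    omega
  · intro h
    by_cases hclose : (k : ℕ) + 1 ≤ i + d
    · obtain ⟨hT, hind⟩ := T_face hd hx (min (i : ℤ) ((n : ℤ) - d + 1)) (by omega) (by omega)
      have := simplex_subface {i, k} _ (by
        intro m hm
        rw [mem_TF]
        rcases Finset.mem_insert.1 hm with rfl | hm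
        · omega
        · rw [Finset.mem_singleton] at hm; subst hm; omega) (by simp) hind
      have h2 := hT.trans' this
      simpa using h2
    · have hi0 : i = 0 := by tauto
      subst hi0
      have hv0 : ((0 : Fin (n + 1)) : ℕ) = 0 := rfl
      rw [hv0] at hclose
      -- intersect all the facets `E_j` containing `x_k`
      set J : Set (Set V) := {G | ∃ j : ℤ, 2 ≤ j ∧ j ≤ n ∧ k ∈ EF d n j ∧
        G = convexHull ℝ (x '' (EF d n j : Set (Fin (n + 1))))} with hJ
      have hJne : J.Nonempty := ⟨_, (k : ℤ) - 1, by omega, by omega, by rw [mem_EF]; omega, rfl⟩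
      have hface : IsFaceOf (convexHull ℝ (Set.range x)) (⋂₀ J) := by
        refine ⟨isExtreme_sInter hJne ?_, convex_sInter ?_, isClosed_sInter ?_⟩
        · rintro _ ⟨j, h1, h2, -, rfl⟩; exact (E_face hd hx j h1 h2).1
        · rintro _ ⟨j, h1, h2, -, rfl⟩; exact (E_face hd hx j h1 h2).2.1
        · rintro _ ⟨j, h1, h2, -, rfl⟩; exact (E_face hd hx j h1 h2).2.2
      have heq : {m | x m ∈ ⋂₀ J} = ({0, k} : Set (Fin (n + 1))) := by
        ext m
        constructor
        · intro hm
          have hm' : ∀ j : ℤ, 2 ≤ j → j ≤ n → k ∈ EF d n j → m ∈ EF d n j := by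
            intro j h1 h2 h3
            have : x m ∈ convexHull ℝ (x '' (EF d n j : Set (Fin (n + 1)))) :=
              hm _ ⟨j, h1, h2, h3, rfl⟩
            exact mem_of_mem_hull hinj hext this
          simp only [mem_EF] at hm'
          have hm2 := m.2
          by_contra hne
          have hne1 : m ≠ 0 := fun h => hne (Or.inl h)
          have hne2 : m ≠ k := fun h => hne (Or.inr h)
          have hne1' : (m : ℕ) ≠ 0 := fun h => hne1 (Fin.ext h)
          have hne2' : (m : ℕ) ≠ k := fun h => hne2 (Fin.ext h)
          rcases lt_or_gt_of_ne hne2' with hlt | hgt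
          · by_cases hc : (k : ℤ) - d + 2 ≤ m
            · have := hm' m (by omega) (by omega) (by omega)
              omega
            · by_cases hkn : (k : ℕ) = n
              · have := hm' n (by omega) (by omega) (by omega)
                omega
              · have := hm' (k + 1) (by omega) (by omega) (by omega)
                omega
          · have := hm' (k - d + 2) (by omega) (by omega) (by omega)
            omega
        · rintro hm G ⟨j, h1, h2, h3, rfl⟩
          apply subset_convexHull ℝ _
          refine ⟨m, ?_, rfl⟩
          rcases hm with rfl | hm
          · rw [Finset.mem_coe, mem_EF]; simp
          · have hm' : m = k := hm
            rw [hm']; exact h3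
      have := face_eq_hull hface
      rw [heq] at this
      rw [← this]; exact hface

open Classical in
/-- index set of the vertices lying in `F` -/
def idx (x : Fin (n + 1) → V) (F : Set V) : Finset (Fin (n + 1)) :=
  Finset.univ.filter fun i => x i ∈ F

lemma mem_idx {F : Set V} {i : Fin (n + 1)} : i ∈ idx x F ↔ x i ∈ F := by simp [idx]

lemma face_eq_idx {F : Set V} (hF : IsFaceOf (convexHull ℝ (Set.range x)) F) :
    F = convexHull ℝ (x '' (idx x F : Set (Fin (n + 1)))) := by
  have h := face_eq_hull hF
  have e : (idx x F : Set (Fin (n + 1))) = {i | x i ∈ F} := by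
    ext i; exact mem_idx
  rw [e]; exact h

lemma two_face_card (hd : 3 ≤ d) (hx : IsBraxtope d n x) (F : Set V)
    (hF : IsFaceOf (convexHull ℝ (Set.range x)) F) (h2 : sdim F = 2) : (idx x F).card = 3 := by
  obtain ⟨hn, hinj, hdim, hext, hfac⟩ := hx.2 hd
  have hFS := face_eq_idx hF
  have hge : 3 ≤ (idx x F).card := by
    have := sdim_le_card (x := x) (idx x F)
    rw [← hFS, h2] at this; omega
  have hSne : (idx x F).Nonempty := by rw [← Finset.card_pos]; omega
  by_cases h0 : x 0 ∈ F
  · by_contra hne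
    have hm0 : (0 : Fin (n + 1)) ∈ idx x F := mem_idx.2 h0
    have hlt : 2 < ((idx x F).erase 0).card := by
      rw [Finset.card_erase_of_mem hm0]; omega
    obtain ⟨a, ha, b, hb, c, hc, hab, hac, hbc⟩ := Finset.two_lt_card.1 hlt
    rw [Finset.mem_erase, mem_idx] at ha hb hc
    have hedge : ∀ a : Fin (n + 1), a ≠ 0 →
        IsFaceOf (convexHull ℝ (Set.range x)) (convexHull ℝ (x '' {0, a})) := fun a ha =>
      (edge_iff hd hx 0 a (Fin.pos_of_ne_zero ha)).2 (Or.inl rfl)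
    exact three_nbrs hinj hext F hF h2 0 a b c h0 ha.2 hb.2 hc.2 ha.1.symm hb.1.symm hc.1.symm
      hab hac hbc (hedge a ha.1) (hedge b hb.1) (hedge c hc.1)
  · obtain ⟨m, hm⟩ := hSne
    obtain ⟨i, hi0, hi1, hsub⟩ := face_in_T hd hx F hF ⟨_, mem_idx.1 hm⟩ h0
    have hST : idx x F ⊆ TF d n i := fun m hm =>
      mem_of_mem_hull hinj hext (hsub (mem_idx.1 hm))
    have hind := (T_face hd hx i hi0 hi1).2
    let e : idx x F ↪ TF d n i := ⟨fun m => ⟨m.1, hST m.2⟩, fun a b h =>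
      Subtype.ext (congrArg (fun z : TF d n i => z.1) h)⟩
    have hind2 : AffineIndependent ℝ fun m : idx x F => x m :=
      hind.comp_embedding e
    have := sdim_affineIndep _ ⟨m, hm⟩ hind2
    rw [← hFS, h2] at this
    omega

/-- pairs of indices spanning an edge -/
def edgePairs (d n : ℕ) : Finset (Fin (n + 1) × Fin (n + 1)) :=
  Finset.univ.filter fun p => p.1 < p.2 ∧ (p.1 = 0 ∨ (p.2 : ℕ) + 1 ≤ p.1 + d)

lemma sum_min (d n : ℕ) (h : d ≤ n) :
    ∑ k ∈ Finset.range (n + 1), min k d = (d + 1).choose 2 + (n - d) * d := by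
  induction n, h using Nat.le_induction with
  | base =>
    rw [Nat.sub_self, zero_mul, add_zero, Nat.choose_two_right, ← Finset.sum_range_id]
    refine Finset.sum_congr rfl fun k hk => min_eq_left ?_
    have := Finset.mem_range.1 hk
    omega
  | succ n hn ih =>
    rw [Finset.sum_range_succ, ih, min_eq_right (by omega), Nat.succ_sub hn, Nat.succ_mul]
    ring

lemma card_edgePairs (hd : 1 ≤ d) (hn : d ≤ n) :
    (edgePairs d n).card = (d + 1).choose 2 + (n - d) * d := by
  rw [← sum_min d n hn, edgePairs, Finset.card_filter, Fintype.sum_prod_type_right]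
  have h1 : ∀ k : Fin (n + 1), (∑ i : Fin (n + 1),
      if i < k ∧ (i = 0 ∨ (k : ℕ) + 1 ≤ i + d) then 1 else 0) = min (k : ℕ) d := by
    intro k
    have hk := k.2
    have e : ∀ i : Fin (n + 1), (if i < k ∧ (i = 0 ∨ (k : ℕ) + 1 ≤ i + d) then 1 else 0) =
        (fun m : ℕ => if m < k ∧ (m = 0 ∨ (k : ℕ) + 1 ≤ m + d) then 1 else 0) (i : ℕ) := by
      intro i
      simp only [Fin.lt_def, Fin.ext_iff, Fin.val_zero]
    rw [Finset.sum_congr rfl (fun i _ => e i), Fin.sum_univ_eq_sum_range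
      (fun m : ℕ => if m < (k : ℕ) ∧ (m = 0 ∨ (k : ℕ) + 1 ≤ m + d) then 1 else 0) (n + 1),
      ← Finset.card_filter]
    rcases Nat.eq_zero_or_pos (k : ℕ) with h0 | hpos
    · simp [h0]
    · have : (Finset.range (n + 1)).filter (fun m : ℕ => m < k ∧ (m = 0 ∨ (k : ℕ) + 1 ≤ m + d)) =
          insert 0 (Finset.Ico (max 1 ((k : ℕ) + 1 - d)) k) := by
        ext m
        simp only [Finset.mem_filter, Finset.mem_range, Finset.mem_insert, Finset.mem_Ico]
        omega
      rw [this, Finset.card_insert_of_notMem (by simp), Nat.card_Ico]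
      omega
  simp only [h1]
  exact Fin.sum_univ_eq_sum_range (fun k => min k d) (n + 1)

lemma pair_eq {i k i' k' : Fin (n + 1)} (hik : i < k) (hik' : i' < k')
    (h : ({i, k} : Set (Fin (n + 1))) ⊆ {i', k'}) : i = i' ∧ k = k' := by
  have h1 : i = i' ∨ i = k' := h (Set.mem_insert _ _)
  have h2 : k = i' ∨ k = k' := h (Set.mem_insert_of_mem _ rfl)
  simp only [Fin.ext_iff, Fin.lt_def] at *
  omega

lemma count_edges (hd : 3 ≤ d) (hx : IsBraxtope d n x) :
    {F : Set V | IsFaceOf (braxQ x) F ∧ sdim F = 1}.ncard = (d + 1).choose 2 + (n - d) * d := by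
  obtain ⟨hn, hinj, hdim, hext, hfac⟩ := hx.2 hd
  rw [← card_edgePairs (by omega) hn, ← Set.ncard_coe_finset]
  have himg : {F : Set V | IsFaceOf (braxQ x) F ∧ sdim F = 1} =
      (fun p : Fin (n + 1) × Fin (n + 1) => convexHull ℝ (x '' {p.1, p.2})) ''
        (edgePairs d n : Set (Fin (n + 1) × Fin (n + 1))) := by
    ext F
    constructor
    · rintro ⟨hF, h1⟩
      obtain ⟨i, k, hik, rfl⟩ := face_dim_one hinj hext F hF h1
      rcases lt_or_gt_of_ne hik with h | h
      · refine ⟨(i, k), ?_, rfl⟩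
        rw [Finset.mem_coe, edgePairs, Finset.mem_filter]
        exact ⟨Finset.mem_univ _, h, (edge_iff hd hx i k h).1 hF⟩
      · have hF' := hF
        rw [Set.pair_comm] at hF'
        refine ⟨(k, i), ?_, by simp only [Set.pair_comm]⟩
        rw [Finset.mem_coe, edgePairs, Finset.mem_filter]
        exact ⟨Finset.mem_univ _, h, (edge_iff hd hx k i h).1 hF'⟩
    · rintro ⟨⟨i, k⟩, hp, rfl⟩
      rw [Finset.mem_coe, edgePairs, Finset.mem_filter] at hp
      exact ⟨(edge_iff hd hx i k hp.2.1).2 hp.2.2, edge_sdim hinj hp.2.1.ne⟩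
  rw [himg, Set.InjOn.ncard_image]
  rintro ⟨i, k⟩ hp ⟨i', k'⟩ hp' h
  rw [Finset.mem_coe, edgePairs, Finset.mem_filter] at hp hp'
  have h' : convexHull ℝ (x '' {i, k}) = convexHull ℝ (x '' {i', k'}) := h
  have := pair_eq hp.2.1 hp'.2.1 (fun m hm => mem_of_mem_hull hinj hext (A := {i', k'}) (by
    rw [← h']; exact subset_convexHull ℝ _ ⟨m, hm, rfl⟩))
  exact Prod.ext this.1 this.2

lemma count_vertices (hd : 3 ≤ d) (hx : IsBraxtope d n x) :
    {F : Set V | IsFaceOf (braxQ x) F ∧ sdim F = 0}.ncard = n + 1 := by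
  obtain ⟨hn, hinj, hdim, hext, hfac⟩ := hx.2 hd
  have himg : {F : Set V | IsFaceOf (braxQ x) F ∧ sdim F = 0} =
      (fun i : Fin (n + 1) => ({x i} : Set V)) '' Set.univ := by
    ext F
    have := face_dim_zero hext F
    constructor
    · intro h
      obtain ⟨i, hi⟩ := this.1 h
      exact ⟨i, trivial, hi.symm⟩
    · rintro ⟨i, -, hi⟩
      exact this.2 ⟨i, hi.symm⟩
  rw [himg, Set.ncard_image_of_injective, Set.ncard_univ, Nat.card_eq_fintype_card,
    Fintype.card_fin]
  intro i j h
  exact hinj (Set.singleton_injective h)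

lemma count_flags (hd : 3 ≤ d) (hx : IsBraxtope d n x) :
    {p : Set V × Set V | IsFaceOf (braxQ x) p.1 ∧ sdim p.1 = 0 ∧
        IsFaceOf (braxQ x) p.2 ∧ sdim p.2 = 2 ∧ p.1 ⊆ p.2}.ncard =
      3 * {F : Set V | IsFaceOf (braxQ x) F ∧ sdim F = 2}.ncard := by
  obtain ⟨hn, hinj, hdim, hext, hfac⟩ := hx.2 hd
  have hfin : {F : Set V | IsFaceOf (braxQ x) F ∧ sdim F = 2}.Finite := by
    refine (Set.finite_range
      (fun s : Finset (Fin (n + 1)) => convexHull ℝ (x '' (s : Set (Fin (n + 1)))))).subset ?_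
    rintro F ⟨hF, -⟩
    exact ⟨idx x F, (face_eq_idx hF).symm⟩
  have himg : {p : Set V × Set V | IsFaceOf (braxQ x) p.1 ∧ sdim p.1 = 0 ∧
        IsFaceOf (braxQ x) p.2 ∧ sdim p.2 = 2 ∧ p.1 ⊆ p.2} =
      (fun q : (_ : Set V) × Fin (n + 1) => (({x q.2} : Set V), q.1)) ''
        ((hfin.toFinset.sigma fun F => idx x F : Finset ((_ : Set V) × Fin (n + 1))) :
          Set ((_ : Set V) × Fin (n + 1))) := by
    ext p
    constructor
    · rintro ⟨h1, h2, h3, h4, h5⟩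
      obtain ⟨i, hi⟩ := (face_dim_zero hext p.1).1 ⟨h1, h2⟩
      refine ⟨⟨p.2, i⟩, ?_, ?_⟩
      · rw [Finset.mem_coe, Finset.mem_sigma]
        refine ⟨hfin.mem_toFinset.2 ⟨h3, h4⟩, mem_idx.2 (h5 ?_)⟩
        rw [hi]; rfl
      · exact Prod.ext hi.symm rfl
    · rintro ⟨⟨F, i⟩, hq, rfl⟩
      rw [Finset.mem_coe, Finset.mem_sigma] at hq
      have hF := hfin.mem_toFinset.1 hq.1
      have hv := (face_dim_zero hext {x i}).2 ⟨i, rfl⟩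
      exact ⟨hv.1, hv.2, hF.1, hF.2, Set.singleton_subset_iff.2 (mem_idx.1 hq.2)⟩
  rw [himg, Set.ncard_image_of_injective, Set.ncard_coe_finset, Finset.card_sigma,
    Finset.sum_congr rfl (g := fun _ => 3), Finset.sum_const, smul_eq_mul, mul_comm,
    Set.ncard_eq_toFinset_card _ hfin]
  · intro F hF
    have hF' := hfin.mem_toFinset.1 hF
    exact two_face_card hd hx F hF'.1 hF'.2
  · rintro ⟨F, i⟩ ⟨G, j⟩ h
    have h1 := congrArg Prod.fst h
    have h2 := congrArg Prod.snd h
    have h1' : i = j := hinj (Set.singleton_injective h1)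
    have h2' : F = G := h2
    subst h1' h2'
    rfl

end brax

/-- The `d`-braxtope `Q` is elementary:
`f_{02}(Q) - 3 f_2(Q) + f_1(Q) - d f_0(Q) + C(d+1, 2) = 0`, where `f_{02}` is
the number of chains (vertex ⊂ 2-face). -/
theorem braxtope_elementary (d n : ℕ) (hd : 3 ≤ d) (hn : d ≤ n)
    (x : Fin (n + 1) → V) (hx : IsBraxtope d n x) :
    ({p : Set V × Set V | IsFaceOf (braxQ x) p.1 ∧ sdim p.1 = 0 ∧
        IsFaceOf (braxQ x) p.2 ∧ sdim p.2 = 2 ∧ p.1 ⊆ p.2}.ncard : ℤ) -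
      3 * ({F : Set V | IsFaceOf (braxQ x) F ∧ sdim F = 2}.ncard : ℤ) +
      ({F : Set V | IsFaceOf (braxQ x) F ∧ sdim F = 1}.ncard : ℤ) -
      (d : ℤ) * ({F : Set V | IsFaceOf (braxQ x) F ∧ sdim F = 0}.ncard : ℤ) +
      ((d + 1).choose 2 : ℤ) = 0 := by
  have h0 := count_vertices hd hx
  have h1 := count_edges hd hx
  have h2 := count_flags hd hx
  rw [h0, h1, h2]
  have hc : ((d + 1).choose 2 : ℤ) * 2 = (d + 1) * d := by
    have h := Finset.sum_range_id_mul_two (d + 1)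
    rw [Finset.sum_range_id, ← Nat.choose_two_right, Nat.add_sub_cancel] at h
    exact_mod_cast h
  push_cast [Nat.cast_sub hn]
  linarith
end
end

section
/- Let Q = Q^{d,n} be a d-braxtope with vertex array x_0 < ... < x_n (n ≥ d ≥ 3). Then the simplices J_i = [x_0, x_i, x_{i+1}, ..., x_{i+d-1}] for 1 ≤ i ≤ n-d+1 are the maximal faces of a triangulation of Q (the triangulation obtained by pulling the vertex x_0). -/
open Set

noncomputable section

variable {V : Type*} [NormedAddCommGroup V] [NormedSpace ℝ V]

/-- The simplex `J_i = [x_0, x_i, x_{i+1}, …, x_{i+d-1}]` of the pulling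
triangulation of the braxtope at `x_0`. -/
def Jverts (d : ℕ) {n : ℕ} (x : Fin (n + 1) → V) (i : ℤ) : Set V :=
  insert (x 0) (xc x '' Set.Icc i (i + (d : ℤ) - 1))

def Jset (d : ℕ) {n : ℕ} (x : Fin (n + 1) → V) (i : ℤ) : Set V :=
  convexHull ℝ (Jverts d x i)


lemma bx_vsp_insert {T : Set V} {o t : V} (ht : t ∈ T) :
    vectorSpan ℝ (insert o T) = Submodule.span ℝ {o - t} ⊔ vectorSpan ℝ T := by
  have h := AffineSubspace.direction_affineSpan_insert (k := ℝ) (s := affineSpan ℝ T) (p₂ := o)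
    (mem_affineSpan ℝ ht)
  rw [affineSpan_insert_affineSpan, direction_affineSpan, direction_affineSpan] at h
  exact h

lemma bx_finrank_insert {T : Set V} (hT : T.Finite) {o t : V} (ht : t ∈ T)
    (ho : o ∉ affineSpan ℝ T) :
    Module.finrank ℝ (vectorSpan ℝ (insert o T)) = Module.finrank ℝ (vectorSpan ℝ T) + 1 := by
  apply le_antisymm
  · exact finrank_vectorSpan_insert_le_set ℝ T o
  · have := finiteDimensional_vectorSpan_of_finite ℝ (hT.insert o)
    apply Submodule.finrank_lt_finrank_of_lt
    apply lt_of_le_of_ne (vectorSpan_mono ℝ (subset_insert _ _))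
    intro h
    apply ho
    have h1 : o - t ∈ vectorSpan ℝ T := by
      rw [h]
      exact vsub_mem_vectorSpan ℝ (mem_insert _ _) (mem_insert_of_mem _ ht)
    have h2 := AffineSubspace.vadd_mem_of_mem_direction (s := affineSpan ℝ T)
      (by rw [direction_affineSpan]; exact h1) (mem_affineSpan ℝ ht)
    simpa using h2

lemma bx_rel {Q : Set V} {ι : Type*} [Fintype ι] [Nonempty ι] (t : ι → V)
    (hF : IsExtreme ℝ Q (convexHull ℝ (range t))) {y : V} (hy : y ∈ Q)
    (hy2 : y ∈ affineSpan ℝ (range t)) : y ∈ convexHull ℝ (range t) := by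
  obtain ⟨w, hw, hwy⟩ := eq_affineCombination_of_mem_affineSpan_of_fintype hy2
  rw [Finset.affineCombination_eq_linear_combination _ _ _ hw] at hwy
  set m : ℝ := ((Fintype.card ι : ℕ) : ℝ) with hm
  have hmpos : 0 < m := by rw [hm]; exact_mod_cast Fintype.card_pos
  obtain ⟨B, hB⟩ : ∃ B : ℝ, ∀ i, w i ≤ B := by
    obtain ⟨B, hB⟩ := (Set.finite_range w).bddAbove
    exact ⟨B, fun i => hB ⟨i, rfl⟩⟩
  set ε : ℝ := 1 / (m * (|B| + 1)) with hε
  have hBp : 0 < |B| + 1 := by positivity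
  have hεp : 0 < ε := by positivity
  have hmem : ∀ v : ι → ℝ, (∀ i, 0 ≤ v i) → ∑ i, v i = 1 →
      ∑ i, v i • t i ∈ convexHull ℝ (range t) := fun v h0 h1 =>
    (convex_convexHull ℝ _).sum_mem (fun i _ => h0 i) h1
      (fun i _ => subset_convexHull ℝ _ ⟨i, rfl⟩)
  have hc := hmem (fun _ => 1 / m) (fun _ => by positivity)
    (by simp [← hm, hmpos.ne'])
  have hz := hmem (fun i => (1 + ε) * (1 / m) - ε * w i) (fun i => by
      have h1 : ε * w i ≤ ε * (|B| + 1) := by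
        have := hB i
        have := le_abs_self B
        gcongr; linarith
      have h2 : ε * (|B| + 1) = 1 / m := by rw [hε]; field_simp
      have h3 : 0 ≤ ε * (1 / m) := by positivity
      nlinarith)
    (by rw [Finset.sum_sub_distrib, ← Finset.mul_sum, ← Finset.mul_sum, hw]; simp [← hm, hmpos.ne'])
  refine hF.left_mem_of_mem_openSegment hy (hF.subset hz) hc ?_
  refine ⟨ε / (1 + ε), 1 / (1 + ε), by positivity, by positivity, by field_simp; ring, ?_⟩
  rw [hwy, Finset.smul_sum, Finset.smul_sum, ← Finset.sum_add_distrib]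
  refine Finset.sum_congr rfl fun i _ => ?_
  rw [smul_smul, smul_smul, ← add_smul]
  congr 1
  field_simp
  ring

lemma bx_rel' {Q T : Set V} (hT : T.Finite) (hne : T.Nonempty)
    (hF : IsExtreme ℝ Q (convexHull ℝ T)) {y : V} (hy : y ∈ Q)
    (hy2 : y ∈ affineSpan ℝ T) : y ∈ convexHull ℝ T := by
  have := hT.fintype
  have := hne.to_subtype
  have := bx_rel (Q := Q) (fun i : T => (i : V)) (by simpa using hF) hy (by simpa using hy2)
  simpa using this

/-- Linear bound on a convex hull from the generators. -/
lemma bx_le_hull (u : V →ₗ[ℝ] ℝ) (o : V) (c : ℝ) {S : Set V} (h : ∀ s ∈ S, u (s - o) ≤ c)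
    {y : V} (hy : y ∈ convexHull ℝ S) : u (y - o) ≤ c := by
  have hc : Convex ℝ {y : V | u y ≤ c + u o} := convex_halfSpace_le u.isLinear _
  have : y ∈ {y : V | u y ≤ c + u o} := by
    refine convexHull_min (fun s hs => ?_) hc hy
    have := h s hs
    rw [map_sub] at this
    show u s ≤ c + u o
    linarith
  rw [map_sub]
  have h2 : u y ≤ c + u o := this
  linarith

lemma bx_sub_mem {S : Set V} {o y : V} (ho : o ∈ S) (hy : y ∈ convexHull ℝ S) :
    y - o ∈ vectorSpan ℝ S := by
  have h1 : y ∈ affineSpan ℝ S := convexHull_subset_affineSpan S hy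
  rw [← direction_affineSpan]
  exact AffineSubspace.vsub_mem_direction h1 (mem_affineSpan ℝ ho)

lemma bx_functional {R T : Set V} (hR : R.Finite) (hTR : T ⊆ R) {o : V} (hoR : o ∈ R)
    (hne : T.Nonempty) (hF : IsExtreme ℝ (convexHull ℝ R) (convexHull ℝ T))
    (hoT : o ∉ convexHull ℝ T)
    (hrank : Module.finrank ℝ (vectorSpan ℝ R) = Module.finrank ℝ (vectorSpan ℝ T) + 1) :
    vectorSpan ℝ (insert o T) = vectorSpan ℝ R ∧
    ∃ u : V →ₗ[ℝ] ℝ, (∀ t ∈ T, u (t - o) = 1) ∧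
      (∀ y ∈ convexHull ℝ R, u (y - o) ≤ 1) ∧
      (∀ y ∈ convexHull ℝ R, u (y - o) = 1 → y ∈ convexHull ℝ T) := by
  have hT := hR.subset hTR
  have ho : o ∉ affineSpan ℝ T := fun h =>
    hoT (bx_rel' hT hne hF (subset_convexHull ℝ _ hoR) h)
  obtain ⟨t, ht⟩ := hne
  have hspan : vectorSpan ℝ (insert o T) = vectorSpan ℝ R := by
    have := finiteDimensional_vectorSpan_of_finite ℝ hR
    apply Submodule.eq_of_le_of_finrank_eq
    · exact vectorSpan_mono ℝ (insert_subset hoR hTR)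
    · rw [hrank, bx_finrank_insert hT ht ho]
  refine ⟨hspan, ?_⟩
  have hnot : t - o ∉ vectorSpan ℝ T := by
    intro h
    apply ho
    have h2 := AffineSubspace.vadd_mem_of_mem_direction (s := affineSpan ℝ T)
      (by rw [direction_affineSpan]; exact neg_mem h) (mem_affineSpan ℝ ht)
    simpa using h2
  obtain ⟨f, hf, hker⟩ := Submodule.exists_le_ker_of_notMem hnot
  have hu0 : ∃ u : V →ₗ[ℝ] ℝ, u (t - o) = 1 ∧ ∀ v ∈ vectorSpan ℝ T, u v = 0 := by
    refine ⟨(f (t - o))⁻¹ • f, by simp [-map_sub, hf], fun v hv => ?_⟩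
    have : f v = 0 := hker hv
    simp [this]
  obtain ⟨u, hu1, hu0⟩ := hu0
  have h1 : ∀ s ∈ T, u (s - o) = 1 := by
    intro s hs
    have : s - o = (s - t) + (t - o) := by abel
    have h0 : u (s - t) = 0 := hu0 _ (vsub_mem_vectorSpan ℝ hs ht)
    rw [this, map_add, hu1, h0, zero_add]
  have h3 : ∀ y ∈ convexHull ℝ R, u (y - o) = 1 → y ∈ convexHull ℝ T := by
    intro y hy hy1
    have hm := bx_sub_mem hoR hy
    rw [← hspan, bx_vsp_insert ht, Submodule.mem_sup] at hm
    obtain ⟨a, ha, b, hb, hab⟩ := hm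
    obtain ⟨c, rfl⟩ := Submodule.mem_span_singleton.1 ha
    have hc : c = -1 := by
      rw [← hab, map_add, hu0 _ hb, map_smul, ← neg_sub t o, map_neg, hu1] at hy1
      simp at hy1
      linarith
    subst hc
    have hyb : y = b + t := by
      have := eq_add_of_sub_eq hab.symm
      rw [this]; module
    refine bx_rel' hT ⟨t, ht⟩ hF hy ?_
    rw [hyb]
    exact AffineSubspace.vadd_mem_of_mem_direction (s := affineSpan ℝ T)
      (by rw [direction_affineSpan]; exact hb) (mem_affineSpan ℝ ht)
  refine ⟨u, h1, ?_, h3⟩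
  intro y hy
  by_contra hlt
  push Not at hlt
  set a := u (y - o) with ha
  have hapos : 0 < a := by linarith
  have hz : ∃ z, z ∈ openSegment ℝ o y ∧ u (z - o) = 1 := by
    refine ⟨(1 - 1 / a) • o + (1 / a) • y, ⟨1 - 1 / a, 1 / a, ?_, by positivity, by ring, rfl⟩, ?_⟩
    · rw [sub_pos, div_lt_one hapos]; exact hlt
    · have : (1 - 1 / a) • o + (1 / a) • y - o = (1 / a) • (y - o) := by module
      rw [this, map_smul, ← ha]
      field_simp
      simp [hapos.ne']
  obtain ⟨z, hz, hz1⟩ := hz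
  have hoQ := subset_convexHull ℝ _ hoR
  exact hoT (hF.left_mem_of_mem_openSegment hoQ hy
    (h3 z ((convex_convexHull ℝ R).openSegment_subset hoQ hy hz) hz1) hz)

lemma bx_pivot {ι : Type*} [Fintype ι] (e : ι → V) (w : ι → ℝ) (hw : ∀ i, 0 < w i)
    (u₀ : V →ₗ[ℝ] ℝ) (hu₀ : ∀ i, u₀ (e i) ≤ 1) :
    ∃ u : V →ₗ[ℝ] ℝ, (∀ i, u (e i) ≤ 1) ∧
      u₀ (∑ i, w i • e i) ≤ u (∑ i, w i • e i) ∧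
      ∀ i, e i ∈ Submodule.span ℝ (e '' {j | u (e j) = 1}) := by
  classical
  set r := ∑ i, w i • e i with hr
  let P : (V →ₗ[ℝ] ℝ) → Prop := fun u => (∀ i, u (e i) ≤ 1) ∧ u₀ r ≤ u r
  let N : (V →ₗ[ℝ] ℝ) → ℕ := fun u => (Finset.univ.filter fun j => u (e j) = 1).card
  obtain ⟨u, hu, hmax⟩ : ∃ u, P u ∧ ∀ u', P u' → N u' ≤ N u := by
    have hex : ∃ k, ∃ u, P u ∧ Fintype.card ι - N u = k := ⟨_, u₀, ⟨hu₀, le_refl _⟩, rfl⟩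
    obtain ⟨u, hu, hk⟩ := Nat.find_spec hex
    refine ⟨u, hu, fun u' hu' => ?_⟩
    have h1 := Nat.find_min' hex ⟨u', hu', rfl⟩
    have h2 : N u' ≤ Fintype.card ι := Finset.card_le_univ _
    have h3 : N u ≤ Fintype.card ι := Finset.card_le_univ _
    omega
  refine ⟨u, hu.1, hu.2, ?_⟩
  by_contra hcon
  push Not at hcon
  obtain ⟨i₀, hi₀⟩ := hcon
  have hg : ∃ g : V →ₗ[ℝ] ℝ, g (e i₀) ≠ 0 ∧ (∀ j, u (e j) = 1 → g (e j) = 0) ∧ 0 ≤ g r := by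
    obtain ⟨g, hg, hker⟩ := Submodule.exists_le_ker_of_notMem hi₀
    have hz : ∀ j, u (e j) = 1 → g (e j) = 0 := fun j hj =>
      hker (Submodule.subset_span ⟨j, hj, rfl⟩)
    rcases le_total 0 (g r) with h | h
    · exact ⟨g, hg, hz, h⟩
    · refine ⟨-g, by simpa using hg, fun j hj => by simpa using hz j hj, by simpa using h⟩
  obtain ⟨g, hg0, hgz, hgr⟩ := hg
  have hpos : ∃ j, 0 < g (e j) := by
    by_contra hc
    push Not at hc
    have : g r < 0 := by
      rw [hr, map_sum]
      apply Finset.sum_neg'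
      · intro i _
        rw [map_smul, smul_eq_mul]
        exact mul_nonpos_of_nonneg_of_nonpos (hw i).le (hc i)
      · refine ⟨i₀, Finset.mem_univ _, ?_⟩
        rw [map_smul, smul_eq_mul]
        exact mul_neg_of_pos_of_neg (hw i₀) (lt_of_le_of_ne (hc i₀) hg0)
    linarith
  obtain ⟨j₁, hj₁⟩ := hpos
  obtain ⟨j, hj, hmin⟩ := Finset.exists_min_image
    (Finset.univ.filter fun j => 0 < g (e j)) (fun j => (1 - u (e j)) / g (e j))
    ⟨j₁, by simpa using hj₁⟩
  have hjp : 0 < g (e j) := by simpa using hj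
  set t := (1 - u (e j)) / g (e j) with ht
  have ht0 : 0 ≤ t := div_nonneg (by linarith [hu.1 j]) hjp.le
  have hP : P (u + t • g) := by
    constructor
    · intro i
      show u (e i) + t * g (e i) ≤ 1
      rcases le_or_gt (g (e i)) 0 with h | h
      · have := hu.1 i
        nlinarith [mul_nonneg ht0 (neg_nonneg.2 h)]
      · have h2 := hmin i (by simpa using h)
        rw [le_div_iff₀ h] at h2
        linarith
    · show u₀ r ≤ u r + t * g r
      have := hu.2
      have := mul_nonneg ht0 hgr
      linarith
  have hlt : N u < N (u + t • g) := by
    apply Finset.card_lt_card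
    rw [Finset.ssubset_iff_of_subset]
    · refine ⟨j, ?_, ?_⟩
      · simp only [Finset.mem_filter, Finset.mem_univ, true_and]
        show u (e j) + t * g (e j) = 1
        rw [ht, div_mul_cancel₀ _ hjp.ne']; ring
      · simp only [Finset.mem_filter, Finset.mem_univ, true_and]
        intro h
        exact hjp.ne' (hgz j h)
    · intro i
      simp only [Finset.mem_filter, Finset.mem_univ, true_and]
      intro h
      show u (e i) + t * g (e i) = 1
      rw [h, hgz i h]; ring
  exact absurd (hmax _ hP) (by omega)

/-- The zero-slack vertices span the whole exposed face. -/
lemma bx_face_hull {S : Set V} (u : V →ₗ[ℝ] ℝ) (o : V) (c : ℝ) (h : ∀ s ∈ S, u (s - o) ≤ c)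
    {y : V} (hy : y ∈ convexHull ℝ S) (hyc : u (y - o) = c) :
    y ∈ convexHull ℝ {s ∈ S | u (s - o) = c} := by
  classical
  obtain ⟨ι, _, w, z, hw0, hw1, hz, hzy⟩ := mem_convexHull_iff_exists_fintype.1 hy
  have hsum : ∑ i, w i * (c - u (z i - o)) = 0 := by
    have : u y = ∑ i, w i * u (z i) := by
      rw [← hzy, map_sum]; simp
    rw [map_sub] at hyc
    simp only [map_sub, mul_sub, Finset.sum_sub_distrib, ← Finset.sum_mul, hw1]
    linarith
  have hzero := (Finset.sum_eq_zero_iff_of_nonneg (fun i _ =>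
    mul_nonneg (hw0 i) (sub_nonneg.2 (h _ (hz i))))).1 hsum
  rw [← hzy]
  have hne : ∀ i, w i ≠ 0 → z i ∈ {s ∈ S | u (s - o) = c} := by
    intro i hi
    refine ⟨hz i, ?_⟩
    have := hzero i (Finset.mem_univ i)
    rcases mul_eq_zero.1 this with h | h
    · exact absurd h hi
    · linarith
  rw [← Finset.sum_filter_of_ne (p := fun i => w i ≠ 0)
    (fun i _ hi h => hi (by simp [h]))]
  refine (convex_convexHull ℝ _).sum_mem (fun i _ => hw0 i) ?_ ?_
  · rw [Finset.sum_filter_of_ne (fun i _ hi => hi), hw1]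
  · intro i hi
    exact subset_convexHull ℝ _ (hne i (by simpa using hi))

lemma bx_exposed {C : Set V} (u : V →ₗ[ℝ] ℝ) (o : V) (c : ℝ) (h : ∀ y ∈ C, u (y - o) ≤ c) :
    IsExtreme ℝ C {y ∈ C | u (y - o) = c} := by
  refine ⟨fun y hy => hy.1, ?_⟩
  rintro a ha b hb z ⟨hz, hzc⟩ ⟨α, β, hα, hβ, hαβ, rfl⟩
  refine ⟨ha, le_antisymm (h a ha) ?_⟩
  have hb' := h b hb
  have heq : α • a + β • b - o = α • (a - o) + β • (b - o) := by
    have : o = (α + β) • o := by rw [hαβ, one_smul]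
    nth_rw 1 [this]; module
  rw [heq, map_add, map_smul, map_smul, smul_eq_mul, smul_eq_mul] at hzc
  by_contra hlt
  push Not at hlt
  have h1 := mul_lt_mul_of_pos_left hlt hα
  have h2 := mul_le_mul_of_nonneg_left hb' hβ.le
  have : α * c + β * c = c := by rw [← add_mul, hαβ, one_mul]
  linarith

lemma bx_cover_pos {ι κ : Type*} [Fintype ι] (x : ι → V) (i₀ : ι) (K : Finset κ)
    (hK : K.Nonempty) (T : κ → Set V) (u : κ → V →ₗ[ℝ] ℝ)
    (hu2 : ∀ k ∈ K, ∀ y ∈ convexHull ℝ (range x), u k (y - x i₀) ≤ 1)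
    (hu3 : ∀ k ∈ K, ∀ y ∈ convexHull ℝ (range x), u k (y - x i₀) = 1 →
      y ∈ convexHull ℝ (T k))
    (hfac : ∀ u' : V →ₗ[ℝ] ℝ, (∀ i, u' (x i - x i₀) ≤ 1) →
      (∀ i, x i - x i₀ ∈ Submodule.span ℝ ((fun i => x i - x i₀) '' {j | u' (x j - x i₀) = 1})) →
      ∃ k ∈ K, ∀ i, u' (x i - x i₀) = u k (x i - x i₀))
    (w : ι → ℝ) (hw : ∀ i, 0 < w i) (hw1 : ∑ i, w i = 1) :
    ∃ k ∈ K, ∑ i, w i • x i ∈ convexHull ℝ (insert (x i₀) (T k)) := by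
  set o := x i₀ with ho
  set r := ∑ i, w i • (x i - o) with hr
  have hp : ∑ i, w i • x i = o + r := by
    simp only [hr, smul_sub, Finset.sum_sub_distrib, ← Finset.sum_smul, hw1, one_smul]
    abel
  have hfin : (range x).Finite := Set.finite_range x
  have hpQ : o + r ∈ convexHull ℝ (range x) := by
    rw [← hp]
    exact (convex_convexHull ℝ _).sum_mem (fun i _ => (hw i).le) hw1
      (fun i _ => subset_convexHull ℝ _ ⟨i, rfl⟩)
  have key : ∀ l : ℝ, 0 ≤ l → (∀ k ∈ K, l * u k r ≤ 1) → o + l • r ∈ convexHull ℝ (range x) := by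
    intro l hl hk
    by_contra hnot
    obtain ⟨f, s, hfs, hsf⟩ := geometric_hahn_banach_closed_point
      (convex_convexHull ℝ (range x)) (hfin.isClosed_convexHull ℝ) hnot
    have hos : f o < s := hfs o (subset_convexHull ℝ _ ⟨i₀, rfl⟩)
    have hsp : 0 < s - f o := by linarith
    obtain ⟨u', h1, h2, h3⟩ := bx_pivot (fun i => x i - o) w hw
      ((s - f o)⁻¹ • (f : V →ₗ[ℝ] ℝ)) (by
        intro i
        have := hfs (x i) (subset_convexHull ℝ _ ⟨i, rfl⟩)
        simp only [LinearMap.smul_apply, smul_eq_mul]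
        rw [inv_mul_le_iff₀ hsp]
        simp only [ContinuousLinearMap.coe_coe, map_sub]
        linarith)
    obtain ⟨k, hkK, hkeq⟩ := hfac u' h1 h3
    have h4 : u' r = u k r := by
      simp only [hr, map_sum, map_smul, hkeq]
    have h5 : 1 < l * ((s - f o)⁻¹ * f r) := by
      have : s < f o + l * f r := by simpa using hsf
      have h6 : l * ((s - f o)⁻¹ * f r) = (l * f r) / (s - f o) := by field_simp
      rw [h6, lt_div_iff₀ hsp]; linarith
    have h7 : (s - f o)⁻¹ * f r ≤ u' r := by simpa [← hr, -map_sum] using h2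
    have h8 := mul_le_mul_of_nonneg_left h7 hl
    have h9 := hk k hkK
    rw [h4] at h8
    linarith
  obtain ⟨k, hkK, hmax⟩ := Finset.exists_max_image K (fun k => u k r) hK
  refine ⟨k, hkK, ?_⟩
  have hoJ : o ∈ convexHull ℝ (insert o (T k)) := subset_convexHull ℝ _ (mem_insert _ _)
  rw [hp]
  by_cases hr0 : r = 0
  · rw [hr0, add_zero]; exact hoJ
  rcases le_or_gt (u k r) 0 with hM | hM
  · exfalso
    obtain ⟨C, hC⟩ := (hfin.isCompact_convexHull ℝ).isBounded.exists_norm_le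
    have hrn : 0 < ‖r‖ := norm_pos_iff.2 hr0
    have hC0 : 0 ≤ C := (norm_nonneg _).trans (hC _ hpQ)
    have h1 := key ((C + ‖o‖ + 1) / ‖r‖) (by positivity) (fun k' hk' => by
      have h2 := (hmax k' hk').trans hM
      have : 0 ≤ (C + ‖o‖ + 1) / ‖r‖ := by positivity
      nlinarith)
    have h2 := hC _ h1
    have h3 : ‖((C + ‖o‖ + 1) / ‖r‖) • r‖ = C + ‖o‖ + 1 := by
      rw [norm_smul, Real.norm_of_nonneg (by positivity)]
      field_simp
    have h4 : ‖((C + ‖o‖ + 1) / ‖r‖) • r‖ ≤ ‖o + ((C + ‖o‖ + 1) / ‖r‖) • r‖ + ‖o‖ := by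
      have := norm_sub_le (o + ((C + ‖o‖ + 1) / ‖r‖) • r) o
      rwa [add_sub_cancel_left] at this
    linarith
  · set M := u k r with hMdef
    have hy := key (1 / M) (by positivity) (fun k' hk' => by
      rw [one_div, inv_mul_le_iff₀ hM]; simpa using hmax k' hk')
    have hyT := hu3 k hkK _ hy (by
      rw [add_sub_cancel_left, map_smul, ← hMdef]; simp [hM.ne'])
    have hM1 : M ≤ 1 := by
      have := hu2 k hkK _ hpQ
      rwa [add_sub_cancel_left] at this
    have hyJ := convexHull_mono (subset_insert o (T k)) hyT
    have := (convex_convexHull ℝ (insert o (T k))) hoJ hyJ (sub_nonneg.2 hM1) hM.le (by ring)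
    have heq : (1 - M) • o + M • (o + (1 / M) • r) = o + r := by
      rw [smul_add, smul_smul, mul_one_div_cancel hM.ne']; module
    rwa [heq] at this

lemma bx_cover {ι κ : Type*} [Fintype ι] (x : ι → V) (i₀ : ι) (K : Finset κ)
    (hK : K.Nonempty) (T : κ → Set V) (hT : ∀ k ∈ K, (T k).Finite) (u : κ → V →ₗ[ℝ] ℝ)
    (hu2 : ∀ k ∈ K, ∀ y ∈ convexHull ℝ (range x), u k (y - x i₀) ≤ 1)
    (hu3 : ∀ k ∈ K, ∀ y ∈ convexHull ℝ (range x), u k (y - x i₀) = 1 →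
      y ∈ convexHull ℝ (T k))
    (hfac : ∀ u' : V →ₗ[ℝ] ℝ, (∀ i, u' (x i - x i₀) ≤ 1) →
      (∀ i, x i - x i₀ ∈ Submodule.span ℝ ((fun i => x i - x i₀) '' {j | u' (x j - x i₀) = 1})) →
      ∃ k ∈ K, ∀ i, u' (x i - x i₀) = u k (x i - x i₀))
    (p : V) (hp : p ∈ convexHull ℝ (range x)) :
    ∃ k ∈ K, p ∈ convexHull ℝ (insert (x i₀) (T k)) := by
  classical
  have hne : Nonempty ι := ⟨i₀⟩
  have hclosed : IsClosed (⋃ k ∈ (K : Set κ), convexHull ℝ (insert (x i₀) (T k))) :=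
    K.finite_toSet.isClosed_biUnion fun k hk => ((hT k hk).insert _).isClosed_convexHull ℝ
  obtain ⟨w, hw0, hw1, hwp⟩ : ∃ w : ι → ℝ, (∀ i, 0 ≤ w i) ∧ ∑ i, w i = 1 ∧
      ∑ i, w i • x i = p := by
    have hconv : Convex ℝ {p : V | ∃ w : ι → ℝ, (∀ i, 0 ≤ w i) ∧ ∑ i, w i = 1 ∧
      ∑ i, w i • x i = p} := by
      rintro _ ⟨v, hv0, hv1, rfl⟩ _ ⟨w, hw0, hw1, rfl⟩ a b ha hb hab
      refine ⟨fun i => a * v i + b * w i, fun i => ?_, ?_, ?_⟩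
      · have := hv0 i
        have := hw0 i
        positivity
      · rw [Finset.sum_add_distrib, ← Finset.mul_sum, ← Finset.mul_sum, hv1, hw1]; linarith
      · simp only [add_smul, Finset.sum_add_distrib, Finset.smul_sum, smul_smul]
    refine convexHull_min ?_ hconv hp
    rintro _ ⟨i, rfl⟩
    refine ⟨Pi.single i 1, fun j => ?_, by simp, ?_⟩
    · by_cases h : j = i
      · subst h; simp
      · simp [h]
    · rw [Finset.sum_eq_single i]
      · simp
      · intro j _ h; simp [h]
      · simp
  set m : ℝ := ((Fintype.card ι : ℕ) : ℝ) with hm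
  have hmpos : 0 < m := by rw [hm]; exact_mod_cast Fintype.card_pos
  let γ : ℝ → V := fun t => ∑ i, ((1 - t) * w i + t * (1 / m)) • x i
  have hγ : Continuous γ := by fun_prop
  have hγ0 : γ 0 = p := by simp [γ, hwp]
  have hmem : ∀ t ∈ Ioo (0 : ℝ) 1, γ t ∈ ⋃ k ∈ (K : Set κ), convexHull ℝ (insert (x i₀) (T k)) := by
    rintro t ⟨ht0, ht1⟩
    obtain ⟨k, hk, hmem⟩ := bx_cover_pos x i₀ K hK T u hu2 hu3 hfac
      (fun i => (1 - t) * w i + t * (1 / m)) (fun i => by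
        have := hw0 i
        have : 0 ≤ (1 - t) * w i := mul_nonneg (by linarith) this
        positivity) (by
        rw [Finset.sum_add_distrib, ← Finset.mul_sum, ← Finset.mul_sum, hw1]
        simp [← hm, hmpos.ne'])
    exact Set.mem_biUnion (s := (K : Set κ)) hk hmem
  have hcl : (0 : ℝ) ∈ closure (Ioo (0 : ℝ) 1) := by
    rw [closure_Ioo (by norm_num)]; simp
  have := map_mem_closure hγ hcl hmem
  rw [hclosed.closure_eq, hγ0] at this
  simpa using this

lemma bx_sdim_hull {S : Set V} (hS : S.Nonempty) :
    sdim (convexHull ℝ S) = (Module.finrank ℝ (vectorSpan ℝ S) : ℤ) := by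
  rw [sdim, if_pos hS.convexHull, affineSpan_convexHull, direction_affineSpan]

lemma bx_xc_mem {n : ℕ} (x : Fin (n + 1) → V) (t : ℤ) : xc x t ∈ range x := ⟨_, rfl⟩

lemma bx_xc_inj {n : ℕ} {x : Fin (n + 1) → V} (hx : Function.Injective x) {s t : ℤ}
    (hs : 0 ≤ s) (hs' : s ≤ n) (ht : 0 ≤ t) (ht' : t ≤ n) (h : xc x s = xc x t) : s = t := by
  have := congrArg Fin.val (hx h)
  simp only at this
  omega

lemma bx_xc_zero {n : ℕ} (x : Fin (n + 1) → V) : xc x 0 = x 0 := by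
  unfold xc
  congr 1

/-- The simplices `J_i = [x_0, x_i, …, x_{i+d-1}]`, `1 ≤ i ≤ n - d + 1`, are
the maximal faces of a triangulation of the braxtope `Q^{d,n}` (the pulling
triangulation at `x_0`): each `J_i` is a `d`-simplex, they cover `Q`, and any
two of them meet in a common face. -/
theorem braxtope_pulling_triangulation (d n : ℕ) (hd : 3 ≤ d) (hn : d ≤ n)
    (x : Fin (n + 1) → V) (hx : IsBraxtope d n x) :
    (∀ i ∈ Set.Icc (1 : ℤ) ((n : ℤ) - d + 1),
      (Jverts d x i).ncard = d + 1 ∧ sdim (Jset d x i) = d) ∧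
    braxQ x = ⋃ i ∈ Set.Icc (1 : ℤ) ((n : ℤ) - d + 1), Jset d x i ∧
    (∀ i ∈ Set.Icc (1 : ℤ) ((n : ℤ) - d + 1),
      ∀ j ∈ Set.Icc (1 : ℤ) ((n : ℤ) - d + 1),
        IsFaceOf (Jset d x i) (Jset d x i ∩ Jset d x j)) := by
  classical
  obtain ⟨-, hinj, hdim, hext, hfacets⟩ := hx.2 hd
  set o := x 0 with ho
  have hR : (range x).Finite := Set.finite_range x
  have hoR : o ∈ range x := ⟨0, rfl⟩
  have hrankR : Module.finrank ℝ (vectorSpan ℝ (range x)) = d := by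
    have h := bx_sdim_hull (S := range x) ⟨o, hoR⟩
    rw [braxQ] at hdim
    rw [hdim] at h
    exact_mod_cast h.symm
  have hTR : ∀ i, Tset d x i ⊆ range x := by
    rintro i _ ⟨t, -, rfl⟩; exact bx_xc_mem x t
  have hTne : ∀ i, (Tset d x i).Nonempty := fun i =>
    ⟨_, i, ⟨le_refl _, by omega⟩, rfl⟩
  have hTfin : ∀ i, (Tset d x i).Finite := fun i => hR.subset (hTR i)
  have hoTset : ∀ i ∈ Set.Icc (1 : ℤ) ((n : ℤ) - d + 1), o ∉ Tset d x i := by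
    rintro i ⟨hi1, hi2⟩ ⟨t, ⟨ht1, ht2⟩, hteq⟩
    rw [ho, ← bx_xc_zero x] at hteq
    have := bx_xc_inj hinj (by omega) (by omega) (by omega) (by omega) hteq
    omega
  have hoT : ∀ i ∈ Set.Icc (1 : ℤ) ((n : ℤ) - d + 1), o ∉ convexHull ℝ (Tset d x i) := by
    intro i hi hmem
    apply hoTset i hi
    apply extremePoints_convexHull_subset (𝕜 := ℝ)
    exact inter_extremePoints_subset_extremePoints_of_subset
      (convexHull_mono (hTR i)) ⟨hmem, hext 0⟩
  have hTfacet : ∀ i ∈ Set.Icc (1 : ℤ) ((n : ℤ) - d + 1),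
      IsFacetOf d (braxQ x) (convexHull ℝ (Tset d x i)) := fun i hi =>
    (hfacets _).2 (Or.inl ⟨i, by linarith [hi.1], hi.2, rfl⟩)
  have hTrank : ∀ i ∈ Set.Icc (1 : ℤ) ((n : ℤ) - d + 1),
      Module.finrank ℝ (vectorSpan ℝ (Tset d x i)) + 1 = d := by
    intro i hi
    have h := (hTfacet i hi).2
    rw [bx_sdim_hull (hTne i)] at h
    omega
  have hfun := fun i (hi : i ∈ Set.Icc (1 : ℤ) ((n : ℤ) - d + 1)) =>
    bx_functional hR (hTR i) hoR (hTne i) (hTfacet i hi).1.1 (hoT i hi)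
      (by rw [hrankR, hTrank i hi])
  have hspan := fun i hi => (hfun i hi).1
  have hfun2 := fun i hi => (hfun i hi).2
  choose! u hu1 hu2 hu3 using hfun2
  have hJfin : ∀ i, (Jverts d x i).Finite := fun i => (hTfin i).insert o
  have hJne : ∀ i, (Jverts d x i).Nonempty := fun i => ⟨o, mem_insert _ _⟩
  have hJR : ∀ i, Jverts d x i ⊆ range x := fun i => insert_subset hoR (hTR i)
  refine ⟨?_, ?_, ?_⟩
  · intro i hi
    constructor
    · have h1 : (Jverts d x i).ncard = (Tset d x i).ncard + 1 :=
        Set.ncard_insert_of_notMem (hoTset i hi) (hTfin i)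
      have h2 : (Tset d x i).ncard = (Set.Icc i (i + (d : ℤ) - 1)).ncard := by
        apply Set.InjOn.ncard_image
        rintro s ⟨hs1, hs2⟩ t ⟨ht1, ht2⟩ hst
        obtain ⟨hi1, hi2⟩ := hi
        exact bx_xc_inj hinj (by omega) (by omega) (by omega) (by omega) hst
      have h3 : (Set.Icc i (i + (d : ℤ) - 1)).ncard = d := by
        rw [← Finset.coe_Icc, Set.ncard_coe_finset, Int.card_Icc]
        omega
      rw [h1, h2, h3]
    · rw [Jset, bx_sdim_hull (hJne i)]
      have h1 : vectorSpan ℝ (Jverts d x i) = vectorSpan ℝ (range x) := hspan i hi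
      rw [h1, hrankR]
  · apply Set.Subset.antisymm
    · intro p hp
      have hcov := bx_cover x 0 (Finset.Icc (1 : ℤ) ((n : ℤ) - d + 1))
        ⟨1, by rw [Finset.mem_Icc]; omega⟩ (Tset d x) (fun k _ => hTfin k) u
        (fun k hk => hu2 k (Finset.mem_Icc.1 hk)) (fun k hk => hu3 k (Finset.mem_Icc.1 hk))
        ?_ p hp
      · obtain ⟨k, hk, hmem⟩ := hcov
        exact Set.mem_biUnion (s := Set.Icc (1 : ℤ) ((n : ℤ) - d + 1)) (Finset.mem_Icc.1 hk) hmem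
      · intro u' hle hsp
        rw [← ho] at hle hsp ⊢
        have hle' : ∀ s ∈ range x, u' (s - o) ≤ 1 := by
          rintro _ ⟨i, rfl⟩; exact hle i
        set Z : Set V := {s ∈ range x | u' (s - o) = 1} with hZ
        have hZR : Z ⊆ range x := fun s hs => hs.1
        have hZfin : Z.Finite := hR.subset hZR
        have hFZ : {y ∈ braxQ x | u' (y - o) = 1} = convexHull ℝ Z := by
          apply Set.Subset.antisymm
          · rintro y ⟨hy, hy1⟩
            exact bx_face_hull u' o 1 hle' hy hy1
          · intro y hy
            refine ⟨convexHull_mono hZR hy, le_antisymm ?_ ?_⟩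
            · exact bx_le_hull u' o 1 (fun s hs => hs.2.le) hy
            · have := bx_le_hull (-u') o (-1) (S := Z)
                (fun s hs => by rw [LinearMap.neg_apply, hs.2]) hy
              rw [LinearMap.neg_apply] at this
              linarith
        have hZne : Z.Nonempty := by
          by_contra hempty
          have h1 : {j | u' (x j - o) = 1} = ∅ := by
            ext j
            simp only [mem_ofPred_eq, mem_empty_iff_false, iff_false]
            intro hj
            exact hempty ⟨x j, ⟨j, rfl⟩, hj⟩
          have h2 := hsp ⟨1, by omega⟩
          rw [h1, image_empty, Submodule.span_empty, Submodule.mem_bot, sub_eq_zero] at h2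
          have h3 := congrArg Fin.val (hinj h2)
          simp at h3
        obtain ⟨z, hz⟩ := hZne
        have hker : vectorSpan ℝ Z ≤ LinearMap.ker u' := by
          rw [vectorSpan_eq_span_vsub_set_right ℝ hz, Submodule.span_le]
          rintro _ ⟨s, hs, rfl⟩
          have h1 : s - z = (s - o) - (z - o) := by abel
          show u' (s - z) = 0
          rw [h1, map_sub, hs.2, hz.2, sub_self]
        have hoZ : o ∉ affineSpan ℝ Z := by
          intro h
          have h1 : z - o ∈ vectorSpan ℝ Z := by
            rw [← direction_affineSpan]
            exact AffineSubspace.vsub_mem_direction (mem_affineSpan ℝ hz) h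
          have h2 : u' (z - o) = 0 := hker h1
          rw [hz.2] at h2
          norm_num at h2
        have hspanZ : vectorSpan ℝ (insert o Z) = vectorSpan ℝ (range x) := by
          apply le_antisymm (vectorSpan_mono ℝ (insert_subset hoR hZR))
          rw [vectorSpan_eq_span_vsub_set_right ℝ hoR, Submodule.span_le]
          rintro _ ⟨_, ⟨i, rfl⟩, rfl⟩
          have hsub : Submodule.span ℝ ((fun i => x i - o) '' {j | u' (x j - o) = 1}) ≤
              vectorSpan ℝ (insert o Z) := by
            rw [Submodule.span_le]
            rintro _ ⟨j, hj, rfl⟩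
            exact vsub_mem_vectorSpan ℝ (mem_insert_of_mem _ ⟨⟨j, rfl⟩, hj⟩) (mem_insert _ _)
          exact hsub (hsp i)
        have hrankZ := bx_finrank_insert hZfin hz hoZ
        rw [hspanZ, hrankR] at hrankZ
        have hfacetZ : IsFacetOf d (braxQ x) (convexHull ℝ Z) := by
          refine ⟨⟨?_, convex_convexHull ℝ _, hZfin.isClosed_convexHull ℝ⟩, ?_⟩
          · rw [← hFZ]
            exact bx_exposed u' o 1 (fun y hy => bx_le_hull u' o 1 hle' hy)
          · rw [bx_sdim_hull ⟨z, hz⟩]; omega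
        have hone : ∀ y ∈ convexHull ℝ Z, u' (y - o) = 1 := by
          intro y hy
          rw [← hFZ] at hy
          exact hy.2
        have honZ : o ∉ convexHull ℝ Z := by
          intro h
          have := hone o h
          simp at this
        rcases (hfacets _).1 hfacetZ with ⟨k, hk0, hk1, hk⟩ | ⟨j, -, -, hj⟩
        · have hkpos : 1 ≤ k := by
            by_contra hlt
            have hk00 : k = 0 := by omega
            apply honZ
            rw [hk, hk00]
            exact subset_convexHull ℝ _ ⟨0, ⟨le_refl _, by omega⟩, bx_xc_zero x⟩
          refine ⟨k, Finset.mem_Icc.2 ⟨hkpos, hk1⟩, fun i => ?_⟩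
          have hmem : x i - o ∈ vectorSpan ℝ (insert o (Tset d x k)) := by
            rw [hspan k ⟨hkpos, hk1⟩]
            exact vsub_mem_vectorSpan ℝ ⟨i, rfl⟩ hoR
          rw [vectorSpan_eq_span_vsub_set_right ℝ (mem_insert o _)] at hmem
          refine LinearMap.eqOn_span ?_ hmem
          rintro _ ⟨s, hs, rfl⟩
          rcases hs with rfl | hs
          · simp
          · show u' (s - o) = u k (s - o)
            rw [hu1 k ⟨hkpos, hk1⟩ s hs]
            apply hone
            rw [hk]
            exact subset_convexHull ℝ _ hs
        · exfalso
          apply honZ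
          rw [hj]
          exact subset_convexHull ℝ _ (mem_insert _ _)
    · apply Set.iUnion₂_subset
      intro i hi
      exact convexHull_mono (hJR i)
  · intro i hi j hj
    have hle : ∀ a ∈ Set.Icc (1 : ℤ) ((n : ℤ) - d + 1), ∀ b ∈ Set.Icc (1 : ℤ) ((n : ℤ) - d + 1),
        ∀ s ∈ Jverts d x a, (u b - u a) (s - o) ≤ 0 := by
      rintro a ha b hb s (hs | hs)
      · rw [hs, ← ho, sub_self, map_zero]
      · rw [LinearMap.sub_apply, hu1 a ha s hs]
        linarith [hu2 b hb s (subset_convexHull ℝ _ (hTR a hs))]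
    have heq : Jset d x i ∩ Jset d x j = {y ∈ Jset d x i | (u j - u i) (y - o) = 0} := by
      apply Set.Subset.antisymm
      · rintro y ⟨hyi, hyj⟩
        refine ⟨hyi, le_antisymm (bx_le_hull _ o 0 (hle i hi j hj) hyi) ?_⟩
        have := bx_le_hull _ o 0 (hle j hj i hi) hyj
        rw [LinearMap.sub_apply] at this ⊢
        linarith
      · rintro y ⟨hyi, hy0⟩
        refine ⟨hyi, ?_⟩
        have h1 := bx_face_hull _ o 0 (hle i hi j hj) hyi hy0
        refine convexHull_min ?_ (convex_convexHull ℝ _) h1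
        rintro s ⟨rfl | hs, hs0⟩
        · exact subset_convexHull ℝ _ (mem_insert _ _)
        · rw [LinearMap.sub_apply, hu1 i hi s hs] at hs0
          exact convexHull_mono (subset_insert _ _)
            (hu3 j hj s (subset_convexHull ℝ _ (hTR i hs)) (by linarith))
    refine ⟨?_, (convex_convexHull ℝ _).inter (convex_convexHull ℝ _),
      ((hJfin i).isClosed_convexHull ℝ).inter ((hJfin j).isClosed_convexHull ℝ)⟩
    rw [heq]
    exact bx_exposed _ o 0 (fun y hy => bx_le_hull _ o 0 (hle i hi j hj) hy)
end
end
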